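/- arXiv:2210.13203 — 3 statements merged into one kernel-verified Lean document; each statement's English description precedes it below -/
import Mathlib

section
/- Let Γ be an infinite countable group. The set of α ∈ Min(Γ) such that (i) α is free (α(γ)(x) = x for some x ∈ X implies γ = 1), (ii) T(α) is unperforated, and (iii) the algebraic preorder ≤ on T(α) is a partial order (antisymmetric), is comeager in Min(Γ). -/
open MeasureTheory Set
open scoped ENNReal

/-! Preliminary definitions: the clopen type semigroup of an action of a group `Γ`
by homeomorphisms on a topological space `X`, invariant measures, dynamical comparison,
topological full groups, and the topology on spaces of actions. -/

/-- The group of self-homeomorphisms of `X`, with `(g * h) x = g (h x)`. -/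
instance homeoGroup (X : Type*) [TopologicalSpace X] : Group (X ≃ₜ X) where
  mul g h := h.trans g
  one := Homeomorph.refl X
  inv := Homeomorph.symm
  mul_assoc a b c := Homeomorph.ext fun _ => rfl
  one_mul a := Homeomorph.ext fun _ => rfl
  mul_one a := Homeomorph.ext fun _ => rfl
  inv_mul_cancel a := Homeomorph.ext fun x => a.symm_apply_apply x

/-- The Cantor space `{0,1}^ℕ`. -/
abbrev Cantor : Type := ℕ → Bool

section Defs

variable {Γ : Type*} [Group Γ] {X : Type*} [TopologicalSpace X]

/-- A left-invariant finitely additive probability measure on (the power set of) `Γ`,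
with values in `[0,1]`. `Γ` is amenable iff such a measure exists. -/
def IsInvFapm {Γ : Type*} [Group Γ] (m : Set Γ → ℝ) : Prop :=
  (∀ E : Set Γ, 0 ≤ m E) ∧ (∀ E : Set Γ, m E ≤ 1) ∧ m Set.univ = 1 ∧
  (∀ E F : Set Γ, Disjoint E F → m (E ∪ F) = m E + m F) ∧
  (∀ (γ : Γ) (E : Set Γ), m ((γ * ·) '' E) = m E)

/-- The action of `γ ∈ Γ` on continuous `ℕ`-valued functions: `(γ · f)(x) = f(γ⁻¹ · x)`. -/
def actC (α : Γ →* X ≃ₜ X) (γ : Γ) (f : C(X, ℕ)) : C(X, ℕ) :=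
  f.comp (α γ⁻¹)

/-- The equidecomposability relation `∼` on `C(X, ℕ)`: `f ∼ g` iff `f = h₁ + ⋯ + hₙ`
and `g = γ₁·h₁ + ⋯ + γₙ·hₙ` for some `hᵢ ∈ C(X,ℕ)`, `γᵢ ∈ Γ`. -/
def TypeRel (α : Γ →* X ≃ₜ X) (f g : C(X, ℕ)) : Prop :=
  ∃ (n : ℕ) (h : Fin n → C(X, ℕ)) (γ : Fin n → Γ),
    f = ∑ i, h i ∧ g = ∑ i, actC α (γ i) (h i)

/-- The additive congruence on `C(X, ℕ)` generated by `∼` (since `∼` is itself an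
additive congruence, this is just `∼`). -/
def typeCon (α : Γ →* X ≃ₜ X) : AddCon C(X, ℕ) := addConGen (TypeRel α)

/-- The clopen type semigroup `T(α) = C(X,ℕ)/∼`. -/
abbrev TypeSemigroup (α : Γ →* X ≃ₜ X) := (typeCon α).Quotient

/-- The class `[f] ∈ T(α)` of `f ∈ C(X, ℕ)`. -/
def cls (α : Γ →* X ≃ₜ X) (f : C(X, ℕ)) : TypeSemigroup α := (typeCon α).toQuotient f

/-- The algebraic preorder on `T(α)`: `a ≤ b` iff `a + c = b` for some `c`. -/
def tle (α : Γ →* X ≃ₜ X) (a b : TypeSemigroup α) : Prop := ∃ c, a + c = b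

/-- `T(α)` is unperforated: `n • a ≤ n • b` implies `a ≤ b` for all `n ≥ 1`. -/
def IsUnperforated (α : Γ →* X ≃ₜ X) : Prop :=
  ∀ (a b : TypeSemigroup α) (n : ℕ), 1 ≤ n → tle α (n • a) (n • b) → tle α a b

/-- `T(α)` is almost unperforated: `(n+1) • a ≤ n • b` implies `a ≤ b`. -/
def IsAlmostUnperforated (α : Γ →* X ≃ₜ X) : Prop :=
  ∀ (a b : TypeSemigroup α) (n : ℕ), tle α ((n + 1) • a) (n • b) → tle α a b

/-- `T(α)` is cancellative: `a + b = a + c` implies `b = c`. -/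
def IsCancellative (α : Γ →* X ≃ₜ X) : Prop :=
  ∀ a b c : TypeSemigroup α, a + b = a + c → b = c

/-- The algebraic preorder on `T(α)` is a partial order, i.e. it is antisymmetric. -/
def TleAntisymm (α : Γ →* X ≃ₜ X) : Prop :=
  ∀ a b : TypeSemigroup α, tle α a b → tle α b a → a = b

/-- `b` is an order unit of `T(α)`: every `a` satisfies `a ≤ k • b` for some `k ∈ ℕ`. -/
def IsOrderUnit (α : Γ →* X ≃ₜ X) (b : TypeSemigroup α) : Prop :=
  ∀ a : TypeSemigroup α, ∃ k : ℕ, tle α a (k • b)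

/-- A state on `T(α)`: an additive map to `[0,∞]` sending `0` to `0`. -/
def IsState (α : Γ →* X ≃ₜ X) (ν : TypeSemigroup α → ℝ≥0∞) : Prop :=
  ν 0 = 0 ∧ ∀ a b : TypeSemigroup α, ν (a + b) = ν a + ν b

/-- `M(α)`: the set of `Γ`-invariant Radon (regular Borel) probability measures on `X`. -/
def invRadon (α : Γ →* X ≃ₜ X) : Set (@Measure X (borel X)) :=
  letI : MeasurableSpace X := borel X
  {μ : Measure X | IsProbabilityMeasure μ ∧ μ.Regular ∧ ∀ γ : Γ, Measure.map ⇑(α γ) μ = μ}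

/-- The set of `Γ`-invariant Borel probability measures on `X`. -/
def invBorel (α : Γ →* X ≃ₜ X) : Set (@Measure X (borel X)) :=
  letI : MeasurableSpace X := borel X
  {μ : Measure X | IsProbabilityMeasure μ ∧ ∀ γ : Γ, Measure.map ⇑(α γ) μ = μ}

/-- `μ([f]) = ∫ f dμ`, the value of (the state associated with) a measure on the class of
`f ∈ C(X, ℕ)`. -/
noncomputable def intOf {X : Type*} [TopologicalSpace X] (μ : @Measure X (borel X))
    (f : C(X, ℕ)) : ℝ :=
  letI : MeasurableSpace X := borel X
  ∫ x, (f x : ℝ) ∂μ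

/-- `A` is subequidecomposable to `B`: there are a partition `A = A₁ ⊔ ⋯ ⊔ Aₙ` into clopen
sets and `γ₁, …, γₙ ∈ Γ` with `γ₁A₁, …, γₙAₙ` pairwise disjoint and contained in `B`. -/
def Subequidecomposable (α : Γ →* X ≃ₜ X) (A B : Set X) : Prop :=
  ∃ (n : ℕ) (P : Fin n → Set X) (γ : Fin n → Γ),
    (∀ i, IsClopen (P i)) ∧ (Pairwise fun i j => Disjoint (P i) (P j)) ∧
    (⋃ i, P i) = A ∧
    (Pairwise fun i j => Disjoint (⇑(α (γ i)) '' P i) (⇑(α (γ j)) '' P j)) ∧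
    ∀ i, ⇑(α (γ i)) '' P i ⊆ B

/-- Dynamical comparison (with respect to invariant Radon probability measures): for all
clopen `A`, `B` with `B` nonempty and `μ(A) < μ(B)` for every `μ ∈ M(α)`, `A` is
subequidecomposable to `B`. -/
def DynComparison (α : Γ →* X ≃ₜ X) : Prop :=
  ∀ A B : Set X, IsClopen A → IsClopen B → B.Nonempty →
    (∀ μ ∈ invRadon α, μ A < μ B) → Subequidecomposable α A B

/-- Dynamical comparison (with respect to invariant Borel probability measures). -/
def DynComparisonBorel (α : Γ →* X ≃ₜ X) : Prop :=
  ∀ A B : Set X, IsClopen A → IsClopen B → B.Nonempty →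
    (∀ μ ∈ invBorel α, μ A < μ B) → Subequidecomposable α A B

/-- The action `α` is minimal: the only closed invariant subsets are `∅` and `X`. -/
def IsMinimalAction (α : Γ →* X ≃ₜ X) : Prop :=
  ∀ F : Set X, IsClosed F → (∀ γ : Γ, ⇑(α γ) '' F ⊆ F) → F = ∅ ∨ F = Set.univ

/-- Membership in the topological full group `⟦α⟧`: `g` coincides with elements of the
action on the pieces of a finite clopen partition of `X`. -/
def InTopFullGroup (α : Γ →* X ≃ₜ X) (g : X ≃ₜ X) : Prop :=
  ∃ (n : ℕ) (P : Fin n → Set X) (γ : Fin n → Γ),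
    (∀ i, IsClopen (P i)) ∧ (Pairwise fun i j => Disjoint (P i) (P j)) ∧
    (⋃ i, P i) = Set.univ ∧ ∀ i, ∀ x ∈ P i, g x = α (γ i) x

/-- `⟦α⟧` admits a dense locally finite subgroup: there is a subgroup `Λ` of `Homeo(X)`
contained in `⟦α⟧`, locally finite (all its finitely generated subgroups are finite), and
dense in `⟦α⟧` for the topology whose basic neighborhoods of `h` are
`{g : g A = h A for all A ∈ 𝒜}`, `𝒜` ranging over finite clopen partitions of `X`. -/
def HasDenseLocallyFiniteSubgroup (α : Γ →* X ≃ₜ X) : Prop :=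
  ∃ Λ : Subgroup (X ≃ₜ X),
    ((Λ : Set (X ≃ₜ X)) ⊆ {g | InTopFullGroup α g}) ∧
    (∀ s : Finset (X ≃ₜ X), (s : Set (X ≃ₜ X)) ⊆ (Λ : Set (X ≃ₜ X)) →
      ((Subgroup.closure (s : Set (X ≃ₜ X)) : Subgroup (X ≃ₜ X)) : Set (X ≃ₜ X)).Finite) ∧
    ∀ g : X ≃ₜ X, InTopFullGroup α g →
      ∀ (n : ℕ) (P : Fin n → Set X), (∀ i, IsClopen (P i)) →
        (Pairwise fun i j => Disjoint (P i) (P j)) → (⋃ i, P i) = Set.univ →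
        ∃ l ∈ Λ, ∀ i, ⇑l '' P i = ⇑g '' P i

end Defs

/-- The topology on `Homeo(X)` whose basic neighborhoods of `h` are the sets
`{g : g A = h A for all A ∈ 𝒜}`, for `𝒜` a finite clopen partition of `X`; equivalently,
the topology generated by the sets `{g : g '' A = B}` for `A`, `B` clopen. -/
def homeoTop (X : Type*) [TopologicalSpace X] : TopologicalSpace (X ≃ₜ X) :=
  TopologicalSpace.generateFrom
    {U | ∃ A B : Set X, IsClopen A ∧ IsClopen B ∧ U = {g : X ≃ₜ X | ⇑g '' A = B}}

/-- The topology on the space `A(Γ)` of actions of `Γ` on `X`, induced from the product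
topology on `Homeo(X)^Γ`. -/
def actionTop (Γ : Type*) [Group Γ] (X : Type*) [TopologicalSpace X] :
    TopologicalSpace (Γ →* (X ≃ₜ X)) :=
  letI := homeoTop X
  TopologicalSpace.induced (fun φ : Γ →* (X ≃ₜ X) => ⇑φ) Pi.topologicalSpace

theorem aux_cantor_homeo {Z : Type*} [TopologicalSpace Z] [CompactSpace Z] [T2Space Z]
    [TotallyDisconnectedSpace Z] [SecondCountableTopology Z] (hp : ∀ z : Z, ¬ IsOpen ({z} : Set Z))
    (p : Z → Cantor) (pc : Continuous p) (ps : Function.Surjective p) (m : ℕ) :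
    ∃ φ : Z ≃ₜ Cantor, ∀ z, ∀ i < m, φ z i = p z i := by
  classical
  haveI : Countable (TopologicalSpace.Clopens Z) :=
    TopologicalSpace.Clopens.countable_iff_secondCountable.2 inferInstance
  obtain ⟨C', hC'⟩ := exists_surjective_nat (TopologicalSpace.Clopens Z)
  let C : ℕ → Set Z := fun n => if n < m then {z | p z n = true} else (C' (n - m) : Set Z)
  have hC : ∀ n, IsClopen (C n) := by
    intro n
    by_cases h : n < m
    · simp only [C, h, if_true]
      exact (isClopen_discrete {true}).preimage ((continuous_apply n).comp pc)
    · simp only [C, h, if_false]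
      exact (C' (n - m)).isClopen
  have hsep : ∀ z w : Z, z ≠ w → ∃ U : Set Z, IsClopen U ∧ z ∈ U ∧ w ∉ U := by
    intro z w hzw
    obtain ⟨U, hU, h1, h2⟩ := exists_isClopen_of_totally_separated hzw
    exact ⟨U, hU, h1, h2⟩
  have hsplit : ∀ (n : ℕ) (D : Set Z), ∃ s : Set Z, IsClopen s ∧
      (IsClopen D → D.Nonempty → (D ∩ s).Nonempty ∧ (D \ s).Nonempty) ∧
      ((D ∩ C n).Nonempty → (D \ C n).Nonempty → s = C n) := by
    intro n D
    by_cases h : (D ∩ C n).Nonempty ∧ (D \ C n).Nonempty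
    · exact ⟨C n, hC n, fun _ _ => h, fun _ _ => rfl⟩
    by_cases hD : IsClopen D ∧ D.Nonempty
    · obtain ⟨hD, z, hz⟩ := hD
      have : ∃ w ∈ D, w ≠ z := by
        by_contra! hcon
        apply hp z
        have : ({z} : Set Z) = D := by
          ext w
          constructor
          · rintro rfl; exact hz
          · intro hw; exact hcon w hw
        rw [this]; exact hD.isOpen
      obtain ⟨w, hw, hwz⟩ := this
      obtain ⟨U, hU, h1, h2⟩ := hsep z w hwz.symm
      exact ⟨U, hU, fun _ _ => ⟨⟨z, hz, h1⟩, ⟨w, hw, h2⟩⟩, fun a b => absurd ⟨a, b⟩ h⟩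
    · exact ⟨univ, isClopen_univ, fun a b => absurd ⟨a, b⟩ hD, fun a b => absurd ⟨a, b⟩ h⟩
  choose sp spc spn spC using hsplit
  let D : Z → ℕ → Set Z := fun z n => Nat.rec univ
    (fun n D => if z ∈ sp n D then D ∩ sp n D else D \ sp n D) n
  have D0 : ∀ z, D z 0 = univ := fun z => rfl
  have DS : ∀ z n, D z (n + 1) =
      if z ∈ sp n (D z n) then D z n ∩ sp n (D z n) else D z n \ sp n (D z n) := fun z n => rfl
  have Dmem : ∀ z n, z ∈ D z n := by
    intro z n
    induction n with
    | zero => simp [D0]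
    | succ n ih =>
      rw [DS]; split_ifs with h
      · exact ⟨ih, h⟩
      · exact ⟨ih, h⟩
  have Dcl : ∀ z n, IsClopen (D z n) := by
    intro z n
    induction n with
    | zero => rw [D0]; exact isClopen_univ
    | succ n ih =>
      rw [DS]; split_ifs with h
      · exact ih.inter (spc _ _)
      · exact ih.diff (spc _ _)
  have key : ∀ n z w, w ∈ D z n → D w n = D z n := by
    intro n
    induction n with
    | zero => intros; rfl
    | succ n ih =>
      intro z w hw
      rw [DS] at hw
      rw [DS, DS]
      split_ifs at hw with h
      · rw [ih z w hw.1, if_pos hw.2, if_pos h]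
      · rw [ih z w hw.1, if_neg hw.2, if_neg h]
  let φ : Z → Cantor := fun z n => decide (z ∈ sp n (D z n))
  have key2 : ∀ n z w, w ∈ D z (n + 1) → φ w n = φ z n := by
    intro n z w hw
    simp only [φ]
    rw [DS] at hw
    split_ifs at hw with h
    · rw [key n z w hw.1]; simp [hw.2, h]
    · rw [key n z w hw.1]; simp [hw.2, h]
  have φc : Continuous φ := by
    refine continuous_pi fun n => ?_
    apply IsLocallyConstant.continuous
    rw [IsLocallyConstant.iff_eventually_eq]
    intro z
    filter_upwards [(Dcl z (n + 1)).isOpen.mem_nhds (Dmem z (n + 1))] with w hw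
    exact key2 n z w hw
  have Deq : ∀ z w n, (∀ i < n, φ z i = φ w i) → D z n = D w n := by
    intro z w n
    induction n with
    | zero => intros; rfl
    | succ n ih =>
      intro h
      have h1 := ih fun i hi => h i (by omega)
      have h2 := h n (by omega)
      simp only [φ, decide_eq_decide] at h2
      rw [DS, DS]
      rw [h1] at h2 ⊢
      simp only [h2]
  have φi : Function.Injective φ := by
    intro z w h
    by_contra hzw
    obtain ⟨U, hU, h1, h2⟩ := hsep z w hzw
    obtain ⟨k, hk⟩ := hC' ⟨U, hU⟩
    have hCU : C (k + m) = U := by simp [C, hk]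
    have hD : D z (k + m) = D w (k + m) := Deq z w _ fun i _ => by rw [h]
    have := spC (k + m) (D z (k + m)) ⟨z, Dmem _ _, by rwa [hCU]⟩
      ⟨w, by rw [hD]; exact Dmem _ _, by rwa [hCU]⟩
    have h3 := congrFun h (k + m)
    simp only [φ, decide_eq_decide] at h3
    rw [← hD, this, hCU] at h3
    exact h2 (h3.1 h1)
  have φs : Function.Surjective φ := by
    intro b
    let E : ℕ → Set Z := fun n => Nat.rec univ
      (fun n D => if b n = true then D ∩ sp n D else D \ sp n D) n
    have ES : ∀ n, E (n + 1) = if b n = true then E n ∩ sp n (E n) else E n \ sp n (E n) :=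
      fun n => rfl
    have hE : ∀ n, IsClopen (E n) ∧ (E n).Nonempty := by
      intro n
      induction n with
      | zero => exact ⟨isClopen_univ, by
          obtain ⟨z, _⟩ := ps (fun _ => true)
          exact ⟨z, mem_univ z⟩⟩
      | succ n ih =>
        rw [ES]
        have := spn n (E n) ih.1 ih.2
        split_ifs
        · exact ⟨ih.1.inter (spc _ _), this.1⟩
        · exact ⟨ih.1.diff (spc _ _), this.2⟩
    have hsub : ∀ n, E (n + 1) ⊆ E n := by
      intro n
      rw [ES]; split_ifs
      · exact inter_subset_left
      · exact diff_subset
    obtain ⟨z, hz⟩ := IsCompact.nonempty_iInter_of_sequence_nonempty_isCompact_isClosed E hsub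
      (fun n => (hE n).2) (hE 0).1.isClosed.isCompact (fun n => (hE n).1.isClosed)
    rw [mem_iInter] at hz
    have hDE : ∀ n, D z n = E n := by
      intro n
      induction n with
      | zero => rfl
      | succ n ih =>
        have := hz (n + 1)
        rw [DS, ES, ih]
        rw [ES] at this
        split_ifs at this with h
        · rw [if_pos h, if_pos this.2]
        · rw [if_neg h, if_neg this.2]
    refine ⟨z, funext fun n => ?_⟩
    simp only [φ, hDE]
    have := hz (n + 1)
    rw [ES] at this
    split_ifs at this with h
    · simp [this.2, h]
    · simp [this.2, h]
  have hsp : ∀ z n, n < m → D z n = {w | ∀ j < n, p w j = p z j} → sp n (D z n) = C n := by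
    intro z n hn h
    have hCn : C n = {w | p w n = true} := by simp [C, hn]
    apply spC
    · obtain ⟨w, hw⟩ := ps (Function.update (p z) n true)
      refine ⟨w, ?_, ?_⟩
      · rw [h]; intro j hj; rw [hw]; simp [hj.ne]
      · rw [hCn]; simp [hw]
    · obtain ⟨w, hw⟩ := ps (Function.update (p z) n false)
      refine ⟨w, ?_, ?_⟩
      · rw [h]; intro j hj; rw [hw]; simp [hj.ne]
      · rw [hCn]; simp [hw]
  have hDm : ∀ z n, n ≤ m → D z n = {w | ∀ j < n, p w j = p z j} := by
    intro z n
    induction n with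
    | zero => intro _; simp [D0]
    | succ n ih =>
      intro hn
      have h1 := ih (by omega)
      have h2 := hsp z n (by omega) h1
      have hCn : C n = {w | p w n = true} := by
        have : n < m := by omega
        simp [C, this]
      rw [DS, h2, h1, hCn]
      ext w
      simp only [Nat.lt_succ_iff_lt_or_eq, mem_setOf_eq]
      cases hz : p z n <;> simp [hz, or_imp, forall_and]
  have hm : ∀ z, ∀ i < m, φ z i = p z i := by
    intro z i hi
    have h2 := hsp z i hi (hDm z i hi.le)
    simp only [φ, h2]
    simp [C, hi]
  exact ⟨Continuous.homeoOfEquivCompactToT2 (f := Equiv.ofBijective φ ⟨φi, φs⟩) φc, hm⟩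
theorem aux_ext {Γ : Type*} [Group Γ] {E : Type*} [TopologicalSpace E] [CompactSpace E]
    [T2Space E] [TotallyDisconnectedSpace E] [SecondCountableTopology E]
    (α : Γ →* (Cantor ≃ₜ Cantor)) (hα : ∀ x : Cantor, Dense (Set.range fun γ : Γ => α γ x))
    (T : Γ → E → E) (Tc : ∀ γ, Continuous (T γ)) (T1 : ∀ e, T 1 e = e)
    (Tm : ∀ a b e, T (a * b) e = T a (T b e))
    (p : E → Cantor) (pc : Continuous p) (hpT : ∀ γ e, p (T γ e) = α γ (p e))
    (M : Set E) (Mc : IsClosed M) (Mn : M.Nonempty) (Mi : ∀ γ, ∀ e ∈ M, T γ e ∈ M) (m : ℕ) :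
    ∃ β : Γ →* (Cantor ≃ₜ Cantor), (∀ x : Cantor, Dense (Set.range fun γ : Γ => β γ x)) ∧
      ∃ q : Cantor → E, Continuous q ∧ (∀ x, q x ∈ M) ∧ (∀ γ x, q (β γ x) = T γ (q x)) ∧
        Function.Surjective (p ∘ q) ∧ ∀ x, ∀ i < m, p (q x) i = x i := by
  obtain ⟨Z, hZM, hZ⟩ := zorn_superset_nonempty
    {F : Set E | IsClosed F ∧ F.Nonempty ∧ ∀ γ, ∀ e ∈ F, T γ e ∈ F} (by
      intro c hc hch hcn
      have := hcn.to_subtype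
      refine ⟨⋂₀ c, ⟨isClosed_sInter fun t ht => (hc ht).1, ?_, ?_⟩, fun s hs =>
        sInter_subset_of_mem hs⟩
      · exact IsCompact.nonempty_sInter_of_directed_nonempty_isCompact_isClosed
          (fun a ha b hb => (hch.total ha hb).elim
            (fun h => ⟨a, ha, subset_rfl, h⟩) (fun h => ⟨b, hb, h, subset_rfl⟩)) (fun t ht => (hc ht).2.1)
          (fun t ht => (hc ht).1.isCompact) (fun t ht => (hc ht).1)
      · intro γ e he t ht
        exact (hc ht).2.2 γ e (he t ht)) M ⟨Mc, Mn, Mi⟩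
  obtain ⟨⟨Zc, Zn, Zi⟩, Zmin⟩ := hZ
  have Zorb : ∀ z ∈ Z, Z ⊆ closure (range fun γ => T γ z) := by
    intro z hz
    apply Zmin
    · refine ⟨isClosed_closure, ⟨T 1 z, subset_closure ⟨1, rfl⟩⟩, ?_⟩
      intro γ e he
      refine map_mem_closure (Tc γ) he ?_
      rintro _ ⟨δ, rfl⟩
      exact ⟨γ * δ, Tm _ _ _⟩
    · refine closure_minimal ?_ Zc
      rintro _ ⟨δ, rfl⟩
      exact Zi δ z hz
  have : CompactSpace Z := isCompact_iff_compactSpace.1 Zc.isCompact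
  let π : Z → Cantor := fun z => p z
  have πc : Continuous π := pc.comp continuous_subtype_val
  have πs : Function.Surjective π := by
    obtain ⟨z, hz⟩ := Zn
    have hcl : IsClosed (range π) := (isCompact_range πc).isClosed
    have hd : Dense (range π) := by
      refine (hα (p z)).mono ?_
      rintro _ ⟨γ, rfl⟩
      exact ⟨⟨T γ z, Zi γ z hz⟩, hpT γ z⟩
    rw [← range_eq_univ, ← hcl.closure_eq]
    exact hd.closure_eq
  have dense : ∀ z : Z, Dense (range fun γ => (⟨T γ z, Zi γ z z.2⟩ : Z)) := by
    intro z w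
    rw [closure_subtype, ← range_comp]
    exact Zorb z z.2 w.2
  let t : Γ → Z → Z := fun γ z => ⟨T γ z, Zi γ z z.2⟩
  have tc : ∀ γ, Continuous (t γ) := fun γ =>
    ((Tc γ).comp continuous_subtype_val).subtype_mk _
  have tm : ∀ a b z, t (a * b) z = t a (t b z) := fun a b z => Subtype.ext (Tm _ _ _)
  have t1 : ∀ z, t 1 z = z := fun z => Subtype.ext (T1 _)
  have hiso : ∀ z : Z, ¬ IsOpen ({z} : Set Z) := by
    intro z hz
    have hcov : (univ : Set Z) ⊆ ⋃ γ, t γ ⁻¹' {z} := by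
      intro w _
      obtain ⟨_, h, ⟨γ, rfl⟩⟩ := (dense w).inter_open_nonempty _ hz ⟨z, rfl⟩
      exact mem_iUnion.2 ⟨γ, h⟩
    obtain ⟨s, hs⟩ := isCompact_univ.elim_finite_subcover _ (fun γ => hz.preimage (tc γ)) hcov
    have hfin : (univ : Set Z).Finite := by
      refine Finite.subset (s.finite_toSet.biUnion (t := fun γ => t γ ⁻¹' {z}) ?_) ?_
      · intro γ _
        refine (finite_singleton z).preimage (Function.Injective.injOn ?_)
        intro a b hab
        have := congrArg (t γ⁻¹) hab
        rwa [← tm, ← tm, inv_mul_cancel, t1, t1] at this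
      · simpa using hs
    have : Finite Z := finite_univ_iff.1 hfin
    have : Finite Cantor := Finite.of_surjective π πs
    exact not_finite Cantor
  obtain ⟨φ, hφ⟩ := aux_cantor_homeo hiso π πc πs m
  let th : Γ → (Z ≃ₜ Z) := fun γ =>
    { toFun := t γ
      invFun := t γ⁻¹
      left_inv := fun z => by rw [← tm, inv_mul_cancel, t1]
      right_inv := fun z => by rw [← tm, mul_inv_cancel, t1]
      continuous_toFun := tc γ
      continuous_invFun := tc γ⁻¹ }
  let β : Γ →* (Cantor ≃ₜ Cantor) :=
    { toFun := fun γ => (φ.symm.trans (th γ)).trans φ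
      map_one' := Homeomorph.ext fun x => by
        change φ (t 1 (φ.symm x)) = x
        rw [t1, φ.apply_symm_apply]
      map_mul' := fun a b => Homeomorph.ext fun x => by
        change φ (t (a * b) (φ.symm x)) = φ (t a (φ.symm (φ (t b (φ.symm x)))))
        rw [φ.symm_apply_apply, tm] }
  have hβ : ∀ γ x, β γ x = φ (t γ (φ.symm x)) := fun _ _ => rfl
  refine ⟨β, ?_, fun x => (φ.symm x : E), continuous_subtype_val.comp φ.symm.continuous,
    fun x => hZM (φ.symm x).2, ?_, ?_, ?_⟩
  · intro x
    have h := DenseRange.comp (g := φ) φ.surjective.denseRange (dense (φ.symm x)) φ.continuous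
    exact h
  · intro γ x
    change (φ.symm (β γ x) : E) = _
    rw [hβ, φ.symm_apply_apply]
  · intro x
    obtain ⟨z, hz⟩ := πs x
    exact ⟨φ z, by simpa [π] using hz⟩
  · intro x i hi
    have := hφ (φ.symm x) i hi
    rw [φ.apply_symm_apply] at this
    exact this.symm
/-- bounded displacement injection -/
def AuxBI {Γ : Type*} [Group Γ] (K : Set Γ) (F G : Γ → ℕ)
    (e : (Σ γ, Fin (F γ)) → (Σ γ, Fin (G γ))) : Prop :=
  Function.Injective e ∧ ∀ p, (e p).1 * p.1⁻¹ ∈ K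

/-- bounded displacement bijection -/
def AuxBD {Γ : Type*} [Group Γ] (K : Set Γ) (F G : Γ → ℕ) : Prop :=
  ∃ e : (Σ γ, Fin (F γ)) ≃ (Σ γ, Fin (G γ)), ∀ p, (e p).1 * p.1⁻¹ ∈ K

theorem AuxBD.add {Γ : Type*} [Group Γ] {K K' : Set Γ} {F G F' G' : Γ → ℕ}
    (h : AuxBD K F G) (h' : AuxBD K' F' G') :
    AuxBD (K ∪ K') (fun γ => F γ + F' γ) (fun γ => G γ + G' γ) := by
  obtain ⟨e, he⟩ := h
  obtain ⟨e', he'⟩ := h'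
  let a : ∀ A B : Γ → ℕ, (Σ γ, Fin (A γ + B γ)) ≃ (Σ γ, Fin (A γ)) ⊕ (Σ γ, Fin (B γ)) :=
    fun A B => (Equiv.sigmaCongrRight fun γ => finSumFinEquiv.symm).trans
      (Equiv.sigmaSumDistrib _ _)
  have ha : ∀ A B s, ((a A B).symm s).1 = Sum.elim Sigma.fst Sigma.fst s := by
    rintro A B (s | s) <;> rfl
  refine ⟨((a F F').trans (Equiv.sumCongr e e')).trans (a G G').symm, ?_⟩
  intro p
  obtain ⟨s, rfl⟩ := (a F F').symm.surjective p
  simp only [Equiv.trans_apply, Equiv.apply_symm_apply, ha]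
  rcases s with s | s
  · exact Or.inl (he s)
  · exact Or.inr (he' s)

/-- the congruence of bounded displacement equidecomposability -/
def auxCon {Γ : Type*} [Group Γ] {X : Type*} [TopologicalSpace X] (α : Γ →* (X ≃ₜ X)) :
    AddCon C(X, ℕ) where
  r f g := ∃ K : Set Γ, K.Finite ∧ ∀ x, AuxBD K (fun γ => f (α γ x)) (fun γ => g (α γ x))
  iseqv := by
    refine ⟨fun f => ⟨{1}, finite_singleton 1, fun x => ⟨Equiv.refl _, fun p => by simp⟩⟩, ?_, ?_⟩
    · rintro f g ⟨K, hK, h⟩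
      refine ⟨K⁻¹, hK.inv, fun x => ?_⟩
      obtain ⟨e, he⟩ := h x
      refine ⟨e.symm, fun p => ?_⟩
      have := he (e.symm p)
      rw [e.apply_symm_apply] at this
      simpa using this
    · rintro f g k ⟨K, hK, h⟩ ⟨L, hL, h'⟩
      refine ⟨image2 (· * ·) L K, hL.image2 _ hK, fun x => ?_⟩
      obtain ⟨e, he⟩ := h x
      obtain ⟨e', he'⟩ := h' x
      refine ⟨e.trans e', fun p => ⟨_, he' (e p), _, he p, ?_⟩⟩
      simp
  add' := by
    rintro f g f' g' ⟨K, hK, h⟩ ⟨L, hL, h'⟩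
    exact ⟨K ∪ L, hK.union hL, fun x => (h x).add (h' x)⟩

theorem aux_typeCon_le {Γ : Type*} [Group Γ] {X : Type*} [TopologicalSpace X]
    (α : Γ →* (X ≃ₜ X)) : typeCon α ≤ auxCon α := by
  refine AddCon.addConGen_le.2 ?_
  rintro f g ⟨n, h, γ, rfl, rfl⟩
  refine AddCon.finsetSum _ _ ?_
  intro i _
  refine ⟨{γ i}, finite_singleton _, fun x => ?_⟩
  have hh : ∀ δ, actC α (γ i) (h i) (α (γ i * δ) x) = h i (α δ x) := by
    intro δ
    change h i (α (γ i)⁻¹ (α (γ i * δ) x)) = _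
    have : α (γ i)⁻¹ (α (γ i * δ) x) = α ((γ i)⁻¹ * (γ i * δ)) x := by
      rw [map_mul α (γ i)⁻¹]; rfl
    rw [this, inv_mul_cancel_left]
  refine ⟨(Equiv.mulLeft (γ i)).sigmaCongr fun δ => finCongr (hh δ).symm, fun p => ?_⟩
  change γ i * p.1 * p.1⁻¹ = γ i
  simp

theorem aux_BI_of_add {Γ : Type*} [Group Γ] {K : Set Γ} {F C G : Γ → ℕ}
    (h : AuxBD K (fun γ => F γ + C γ) G) : ∃ e, AuxBI K F G e := by
  obtain ⟨e, he⟩ := h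
  refine ⟨fun p => e ⟨p.1, Fin.castAdd _ p.2⟩, ?_, fun p => he ⟨p.1, _⟩⟩
  refine e.injective.comp ?_
  rintro ⟨a, i⟩ ⟨b, j⟩ hab
  simp only [Sigma.mk.injEq] at hab
  obtain ⟨rfl, h⟩ := hab
  simpa using h

theorem aux_hall {Γ : Type*} [Group Γ] {K : Set Γ} (hK : K.Finite) {F G : Γ → ℕ} {n : ℕ}
    (hn : 1 ≤ n) (h : ∃ e, AuxBI K (fun γ => F γ * n) (fun γ => G γ * n) e) :
    ∃ e, AuxBI K F G e := by
  classical
  obtain ⟨e, ei, he⟩ := h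
  have hfin : ∀ p : (Σ γ, Fin (F γ)), {q : Σ γ, Fin (G γ) | q.1 * p.1⁻¹ ∈ K}.Finite := by
    intro p
    refine (hK.biUnion (t := fun k => range fun i : Fin (G (k * p.1)) =>
      (⟨k * p.1, i⟩ : Σ γ, Fin (G γ))) fun k _ => finite_range _).subset ?_
    rintro ⟨a, i⟩ hq
    simp only [mem_iUnion]
    refine ⟨_, hq, ?_⟩
    have : a * p.1⁻¹ * p.1 = a := by simp
    simp only [mem_range]
    refine ⟨Fin.cast (by rw [this]) i, ?_⟩
    ext
    · exact this
    · simp only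
      rw [Fin.heq_ext_iff (by rw [this])]
      rfl
  let t : (Σ γ, Fin (F γ)) → Finset (Σ γ, Fin (G γ)) := fun p => (hfin p).toFinset
  have ht : ∀ p q, q ∈ t p ↔ q.1 * p.1⁻¹ ∈ K := fun p q => by simp [t]
  have := (Finset.all_card_le_biUnion_card_iff_exists_injective t).1 ?_
  · obtain ⟨f, fi, hf⟩ := this
    exact ⟨f, fi, fun p => (ht _ _).1 (hf p)⟩
  intro s
  have hcard : (s ×ˢ (Finset.univ : Finset (Fin n))).card ≤
      (s.biUnion t ×ˢ (Finset.univ : Finset (Fin n))).card := by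
    let enc : (Σ γ, Fin (F γ)) × Fin n → (Σ γ, Fin (F γ * n)) :=
      fun p => ⟨p.1.1, finProdFinEquiv (p.1.2, p.2)⟩
    let dec : (Σ γ, Fin (G γ * n)) → (Σ γ, Fin (G γ)) × Fin n :=
      fun q => (⟨q.1, (finProdFinEquiv.symm q.2).1⟩, (finProdFinEquiv.symm q.2).2)
    have enci : Function.Injective enc := by
      rintro ⟨⟨a, i⟩, r⟩ ⟨⟨b, j⟩, r'⟩ hab
      simp only [enc, Sigma.mk.injEq] at hab
      obtain ⟨rfl, h⟩ := hab
      have := finProdFinEquiv.injective (eq_of_heq h)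
      simp_all
    have deci : Function.Injective dec := by
      rintro ⟨a, i⟩ ⟨b, j⟩ hab
      simp only [dec, Prod.mk.injEq, Sigma.mk.injEq] at hab
      obtain ⟨⟨rfl, h⟩, h'⟩ := hab
      have := finProdFinEquiv.symm.injective (Prod.ext (eq_of_heq h) h')
      rw [this]
    refine Finset.card_le_card_of_injOn (fun p => dec (e (enc p))) ?_
      (deci.comp (ei.comp enci)).injOn
    rintro ⟨p, r⟩ hp
    simp only [Finset.coe_product, mem_prod, Finset.mem_coe] at hp ⊢
    refine ⟨Finset.mem_biUnion.2 ⟨p, hp.1, (ht _ _).2 (he (enc (p, r)))⟩, Finset.mem_univ _⟩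
  rw [Finset.card_product, Finset.card_product, Finset.card_univ, Fintype.card_fin] at hcard
  exact Nat.le_of_mul_le_mul_right hcard hn

theorem aux_flow {Γ : Type*} [Group Γ] {K : Finset Γ} {F G : Γ → ℕ}
    (e : (Σ γ, Fin (F γ)) → (Σ γ, Fin (G γ))) (he : AuxBI (K : Set Γ) F G e) :
    ∃ u : Γ → K → ℕ, (∀ γ, ∑ k, u γ k = F γ) ∧ (∀ γ, ∑ k : K, u (k.1⁻¹ * γ) k ≤ G γ) ∧
      (Function.Surjective e → ∀ γ, G γ ≤ ∑ k : K, u (k.1⁻¹ * γ) k) := by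
  classical
  obtain ⟨ei, he⟩ := he
  let v : Γ → Γ → ℕ := fun γ k =>
    (Finset.univ.filter fun i : Fin (F γ) => (e ⟨γ, i⟩).1 * γ⁻¹ = k).card
  let S : ∀ γ : Γ, Finset (Σ k : Γ, Fin (F (k⁻¹ * γ))) := fun γ =>
    K.sigma fun k => Finset.univ.filter fun i => (e ⟨k⁻¹ * γ, i⟩).1 * (k⁻¹ * γ)⁻¹ = k
  have hS : ∀ γ, ∑ k : K, v (k.1⁻¹ * γ) k.1 = (S γ).card := by
    intro γ
    rw [Finset.card_sigma, Finset.sum_coe_sort K fun k => v (k⁻¹ * γ) k]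
  let B : ∀ γ : Γ, Finset (Σ γ, Fin (G γ)) := fun γ => Finset.univ.map (Function.Embedding.sigmaMk γ)
  have hB : ∀ γ, (B γ).card = G γ := by
    intro γ
    simp [B]
  have hBm : ∀ γ q, q ∈ B γ ↔ q.1 = γ := by
    rintro γ ⟨a, i⟩
    simp only [B, Finset.mem_map, Finset.mem_univ, true_and, Function.Embedding.sigmaMk_apply]
    constructor
    · rintro ⟨j, hj⟩
      exact (congrArg Sigma.fst hj).symm
    · rintro rfl
      exact ⟨i, rfl⟩
  let w : ∀ γ : Γ, (Σ k : Γ, Fin (F (k⁻¹ * γ))) → Σ γ, Fin (G γ) := fun γ s => e ⟨s.1⁻¹ * γ, s.2⟩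
  have hSm : ∀ γ s, s ∈ S γ ↔ s.1 ∈ K ∧ (w γ s).1 = γ := by
    intro γ s
    simp only [S, w, Finset.mem_sigma, Finset.mem_filter, Finset.mem_univ, true_and]
    refine and_congr_right fun _ => ?_
    rw [mul_inv_eq_iff_eq_mul, mul_inv_cancel_left]
  refine ⟨fun γ k => v γ k, ?_, ?_, ?_⟩
  · intro γ
    rw [Finset.sum_coe_sort K fun k => v γ k]
    have := Finset.card_eq_sum_card_fiberwise (s := (Finset.univ : Finset (Fin (F γ)))) (t := K)
      (f := fun i => (e ⟨γ, i⟩).1 * γ⁻¹) (fun i _ => he ⟨γ, i⟩)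
    rw [Finset.card_univ, Fintype.card_fin] at this
    exact this.symm
  · intro γ
    rw [hS, ← hB γ]
    refine Finset.card_le_card_of_injOn (w γ) (fun s hs => (hBm _ _).2 ((hSm _ _).1 hs).2) ?_
    rintro ⟨k, i⟩ _ ⟨l, j⟩ _ h
    have h1 := ei h
    simp only [Sigma.mk.injEq, mul_left_inj, inv_inj] at h1
    obtain ⟨rfl, h2⟩ := h1
    rw [eq_of_heq h2]
  · intro es γ
    rw [hS, ← hB γ]
    refine Finset.card_le_card_of_surjOn (w γ) ?_
    intro q hq
    have hq1 := (hBm _ _).1 hq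
    obtain ⟨⟨a, i⟩, rfl⟩ := es q
    have hk := he ⟨a, i⟩
    simp only [hq1] at hk
    have ha : (γ * a⁻¹)⁻¹ * γ = a := by group
    have hs : (⟨(γ * a⁻¹)⁻¹ * γ, Fin.cast (by rw [ha]) i⟩ : Σ γ, Fin (F γ)) = ⟨a, i⟩ := by
      ext
      · exact ha
      · simp only
        rw [Fin.heq_ext_iff (by rw [ha])]
        rfl
    have hw : w γ ⟨γ * a⁻¹, Fin.cast (by rw [ha]) i⟩ = e ⟨a, i⟩ := congrArg e hs
    refine ⟨⟨γ * a⁻¹, Fin.cast (by rw [ha]) i⟩, (hSm _ _).2 ⟨hk, ?_⟩, hw⟩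
    rw [hw]; exact hq1
theorem aux_dep {S : Type*} (f : Cantor → S) (hf : IsLocallyConstant f) :
    ∃ m : ℕ, ∀ x y : Cantor, (∀ i < m, x i = y i) → f x = f y := by
  let U : ℕ → Set Cantor := fun m => {x | ∀ y, (∀ i < m, x i = y i) → f x = f y}
  have hU : ∀ m, IsOpen (U m) := by
    intro m
    rw [isOpen_iff_mem_nhds]
    intro x hx
    have : ∀ᶠ y : Cantor in nhds x, ∀ i < m, y i = x i := by
      have h : ∀ i ∈ Finset.range m, ∀ᶠ y : Cantor in nhds x, y i = x i := by
        intro i _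
        have h0 : ∀ᶠ b : Bool in nhds (x i), b = x i := by simp [nhds_discrete]
        exact (continuous_apply i).continuousAt.eventually h0
      have := (Filter.eventually_all_finset (Finset.range m)).2 h
      simpa using this
    filter_upwards [this] with y hy
    intro z hz
    rw [← hx y fun i hi => (hy i hi).symm]
    exact hx z fun i hi => (hy i hi).symm.trans (hz i hi)
  have hcov : (univ : Set Cantor) ⊆ ⋃ m, U m := by
    intro x _
    have h1 : f ⁻¹' {f x} ∈ nhds x := (hf.isOpen_fiber _).mem_nhds rfl
    rw [nhds_pi, Filter.mem_pi] at h1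
    obtain ⟨I, hI, t, ht, hsub⟩ := h1
    obtain ⟨m, hm⟩ := hI.bddAbove
    refine mem_iUnion.2 ⟨m + 1, fun y hy => ?_⟩
    have : y ∈ f ⁻¹' {f x} := hsub fun i hi => by
      rw [← hy i (Nat.lt_succ_of_le (hm hi))]
      exact mem_of_mem_nhds (ht i)
    exact this.symm
  have hdir : Directed (· ⊆ ·) U := by
    refine directed_of_isDirected_le ?_
    intro a b hab x hx y hy
    exact hx y fun i hi => hy i (lt_of_lt_of_le hi hab)
  obtain ⟨m, hm⟩ := isCompact_univ.elim_directed_cover U hU hcov hdir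
  exact ⟨m, fun x y h => hm (mem_univ x) y h⟩

theorem aux_dep_set {A : Set Cantor} (hA : IsClopen A) :
    ∃ m : ℕ, ∀ x y : Cantor, (∀ i < m, x i = y i) → (x ∈ A ↔ y ∈ A) := by
  have : IsLocallyConstant (fun x => x ∈ A) := by
    rw [IsLocallyConstant.iff_eventually_eq]
    intro x
    by_cases hx : x ∈ A
    · filter_upwards [hA.isOpen.mem_nhds hx] with y hy
      simp [hx, hy]
    · filter_upwards [hA.compl.isOpen.mem_nhds hx] with y hy
      simp only [mem_compl_iff] at hy
      simp [hx, hy]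
  obtain ⟨m, hm⟩ := aux_dep _ this
  exact ⟨m, fun x y h => iff_of_eq (hm x y h)⟩

theorem aux_dep_nat (f : C(Cantor, ℕ)) :
    ∃ m : ℕ, ∀ x y : Cantor, (∀ i < m, x i = y i) → f x = f y :=
  aux_dep f ((IsLocallyConstant.iff_continuous _).2 f.continuous)

theorem aux_countable : Countable C(Cantor, ℕ) := by
  have : Function.Injective (fun f : C(Cantor, ℕ) =>
      (⟨(aux_dep_nat f).choose, fun v => f fun i => if h : i < _ then v ⟨i, h⟩ else false⟩ :
        Σ m : ℕ, ((Fin m → Bool) → ℕ))) := by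
    intro f g h
    have hf := (aux_dep_nat f).choose_spec
    have hg := (aux_dep_nat g).choose_spec
    simp only [Sigma.mk.injEq] at h
    obtain ⟨h1, h2⟩ := h
    generalize (aux_dep_nat f).choose = a at *
    generalize (aux_dep_nat g).choose = b at *
    subst h1
    have h3 := eq_of_heq h2
    ext x
    have h4 := congrFun h3 (fun i => x i)
    rw [hf x _ fun i hi => ?_, hg x _ fun i hi => ?_]
    · exact h4
    · simp [hi]
    · simp [hi]
  exact this.countable

theorem aux_ext2 {Γ : Type*} [Group Γ] [Countable Γ] {S : Type*} [Finite S] [TopologicalSpace S]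
    [DiscreteTopology S]
    (α : Γ →* (Cantor ≃ₜ Cantor)) (hα : ∀ x : Cantor, Dense (Set.range fun γ : Γ => α γ x))
    (M : Set (Cantor × (Γ → S))) (Mc : IsClosed M) (Mn : M.Nonempty)
    (Mi : ∀ (γ : Γ) (x u), (x, u) ∈ M → (α γ x, fun g => u (g * γ)) ∈ M) (m : ℕ) :
    ∃ β : Γ →* (Cantor ≃ₜ Cantor), (∀ x : Cantor, Dense (Set.range fun γ : Γ => β γ x)) ∧
      ∃ (π : Cantor → Cantor) (c : Cantor → Γ → S), Continuous π ∧ Continuous c ∧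
        (∀ x, (π x, c x) ∈ M) ∧
        (∀ γ x, π (β γ x) = α γ (π x)) ∧ (∀ γ x g, c (β γ x) g = c x (g * γ)) ∧
        ∀ x, ∀ i < m, π x i = x i := by
  obtain ⟨β, hβ, q, qc, qM, qT, -, hq⟩ := aux_ext α hα
    (fun γ e => ((α γ e.1, fun g => e.2 (g * γ)) : Cantor × (Γ → S)))
    (fun γ => by
      refine ((α γ).continuous.comp continuous_fst).prodMk ?_
      exact continuous_pi fun g => (continuous_apply _).comp continuous_snd)
    (fun e => by simp only [map_one, mul_one]; rfl)
    (fun a b e => by simp only [map_mul, mul_assoc]; rfl)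
    Prod.fst continuous_fst (fun γ e => rfl) M Mc Mn (fun γ e he => Mi γ e.1 e.2 he) m
  refine ⟨β, hβ, fun x => (q x).1, fun x => (q x).2, continuous_fst.comp qc,
    continuous_snd.comp qc, qM, ?_, ?_, hq⟩
  · intro γ x; simp only [qT]
  · intro γ x g; simp only [qT]

/-- `β` is near `α`: it is an extension agreeing with `α` on the first `m` coordinates. -/
def AuxNear {Γ : Type*} [Group Γ] (α β : Γ →* (Cantor ≃ₜ Cantor)) (m : ℕ) : Prop :=
  ∃ π : Cantor → Cantor, (∀ γ x, π (β γ x) = α γ (π x)) ∧ ∀ x, ∀ i < m, π x i = x i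

theorem aux_flow_ext {Γ : Type*} [Group Γ] [Countable Γ]
    (α : Γ →* (Cantor ≃ₜ Cantor)) (hα : ∀ x : Cantor, Dense (Set.range fun γ : Γ => α γ x))
    (f g : C(Cantor, ℕ)) (K : Set Γ) (hK : K.Finite) (s : Prop) (x₀ : Cantor)
    (he : ∃ e, AuxBI K (fun γ => f (α γ x₀)) (fun γ => g (α γ x₀)) e ∧
      (s → Function.Surjective e)) (m : ℕ) :
    ∃ β : Γ →* (Cantor ≃ₜ Cantor), (∀ x : Cantor, Dense (Set.range fun γ : Γ => β γ x)) ∧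
      AuxNear α β m ∧ ∃ g' : C(Cantor, ℕ), typeCon β f g' ∧ g' ≤ g ∧ (s → g' = g) := by
  classical
  lift K to Finset Γ using hK
  obtain ⟨e, he, hes⟩ := he
  obtain ⟨u, hu1, hu2, hu3⟩ := aux_flow e he
  obtain ⟨mf, hmf⟩ := aux_dep_nat f
  obtain ⟨mg, hmg⟩ := aux_dep_nat g
  obtain ⟨N, hN⟩ : ∃ N, ∀ x, f x ≤ N := by
    obtain ⟨N, hN⟩ := (isCompact_range f.continuous).bddAbove
    exact ⟨N, fun x => hN ⟨x, rfl⟩⟩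
  have huN : ∀ γ k, u γ k < N + 1 := by
    intro γ k
    have h1 : u γ k ≤ ∑ k, u γ k := Finset.single_le_sum (fun _ _ => Nat.zero_le _)
      (Finset.mem_univ k)
    rw [hu1] at h1
    have := hN (α γ x₀)
    omega
  let M : Set (Cantor × (Γ → K → Fin (N + 1))) :=
    {p | ∀ γ, ∑ k, (p.2 γ k : ℕ) = f (α γ p.1) ∧
      ∑ k : K, (p.2 (k.1⁻¹ * γ) k : ℕ) ≤ g (α γ p.1) ∧
      (s → g (α γ p.1) ≤ ∑ k : K, (p.2 (k.1⁻¹ * γ) k : ℕ))}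
  have hc : ∀ γ k, Continuous fun p : Cantor × (Γ → K → Fin (N + 1)) => (p.2 γ k : ℕ) := by
    intro γ k
    exact continuous_of_discreteTopology.comp
      ((continuous_apply k).comp ((continuous_apply γ).comp continuous_snd))
  have hfc : ∀ (f : C(Cantor, ℕ)) γ,
      Continuous fun p : Cantor × (Γ → K → Fin (N + 1)) => f (α γ p.1) :=
    fun f γ => f.continuous.comp ((α γ).continuous.comp continuous_fst)
  have Mc : IsClosed M := by
    simp only [M, setOf_forall, setOf_and]
    refine isClosed_iInter fun γ => IsClosed.inter ?_ (IsClosed.inter ?_ (isClosed_iInter fun _ => ?_))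
    · exact isClosed_eq (continuous_finset_sum _ fun k _ => hc γ k) (hfc f γ)
    · exact isClosed_le (continuous_finset_sum _ fun k _ => hc _ k) (hfc g γ)
    · exact isClosed_le (hfc g γ) (continuous_finset_sum _ fun k _ => hc _ k)
  have Mn : M.Nonempty := by
    refine ⟨(x₀, fun γ k => ⟨u γ k, huN γ k⟩), fun γ => ⟨hu1 γ, hu2 γ, fun hs => hu3 (hes hs) γ⟩⟩
  have Mi : ∀ (γ : Γ) (x u), (x, u) ∈ M → (α γ x, fun g => u (g * γ)) ∈ M := by
    intro γ x u h δ
    have := h (δ * γ)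
    rw [map_mul] at this
    simp only [mul_assoc]
    exact this
  obtain ⟨β, hβ, π, c, πc, cc, hM, hπ, hcβ, hm⟩ :=
    aux_ext2 α hα M Mc Mn Mi (max m (max mf mg))
  refine ⟨β, hβ, ⟨π, hπ, fun x i hi => hm x i (lt_of_lt_of_le hi (le_max_left _ _))⟩, ?_⟩
  have hf : ∀ x, f (π x) = f x := fun x => hmf _ _ fun i hi => hm x i (by
    simp only [lt_max_iff]; tauto)
  have hg : ∀ x, g (π x) = g x := fun x => hmg _ _ fun i hi => hm x i (by
    simp only [lt_max_iff]; tauto)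
  let h : K → C(Cantor, ℕ) := fun k => ⟨fun x => (c x 1 k : ℕ),
    continuous_of_discreteTopology.comp ((continuous_apply k).comp ((continuous_apply 1).comp cc))⟩
  have hact : ∀ (k : K) x, actC β k.1 (h k) x = (c x (k.1⁻¹) k : ℕ) := by
    intro k x
    change (c (β k.1⁻¹ x) 1 k : ℕ) = _
    rw [hcβ, one_mul]
  have hsum : f = ∑ k, h k := by
    ext x
    rw [ContinuousMap.sum_apply]
    have := (hM x 1).1
    simp only [map_one] at this
    exact (hf x).symm.trans this.symm
  have hsum' : ∀ x, (∑ k : K, actC β k.1 (h k)) x = ∑ k : K, (c x (k.1⁻¹ * 1) k : ℕ) := by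
    intro x
    rw [ContinuousMap.sum_apply]
    exact Finset.sum_congr rfl fun k _ => by rw [hact, mul_one]
  refine ⟨∑ k : K, actC β k.1 (h k), ?_, ?_, ?_⟩
  · rw [hsum]
    refine AddCon.finsetSum _ _ fun k _ => ?_
    exact AddConGen.Rel.of _ _ ⟨1, fun _ => h k, fun _ => k.1, by simp, by simp⟩
  · intro x
    have := (hM x 1).2.1
    change (∑ k : K, actC β k.1 (h k)) x ≤ g x
    rw [hsum', ← hg x]
    simp only [map_one] at this
    exact this
  · intro hs
    ext x
    have h1 := (hM x 1).2.1
    have h2 := (hM x 1).2.2 hs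
    rw [hsum', ← hg x]
    simp only [map_one] at h1 h2
    exact le_antisymm h1 h2
theorem aux_color {G : Type*} (σ : Equiv.Perm G) (hσ : ∀ x, σ x ≠ x) :
    ∃ c : G → Fin 3, ∀ x, c (σ x) ≠ c x := by
  classical
  obtain ⟨A, hA, hmax⟩ := zorn_subset {A : Set G | ∀ x ∈ A, σ x ∉ A} (by
    intro c hc hch
    refine ⟨⋃₀ c, ?_, fun s hs => subset_sUnion_of_mem hs⟩
    rintro x ⟨s, hs, hx⟩ ⟨t, ht, hx'⟩
    rcases hch.total hs ht with h | h
    · exact hc ht x (h hx) hx'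
    · exact hc hs x hx (h hx'))
  have hA' : ∀ x, x ∉ A → σ x ∈ A ∨ σ.symm x ∈ A := by
    intro x hx
    by_contra! hcon
    refine hx (hmax (y := insert x A) ?_ (subset_insert _ _) (mem_insert _ _))
    intro y hy hy'
    rcases hy with rfl | hy <;> rcases hy' with h | h
    · exact hσ _ h
    · exact hcon.1 h
    · rw [← h, σ.symm_apply_apply] at hcon
      exact hcon.2 hy
    · exact hA y hy h
  refine ⟨fun x => if x ∈ A then 0 else if σ.symm x ∈ A then 1 else 2, fun x => ?_⟩
  have h1 := hA x
  have h2 := hA' x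
  have h3 := hA' (σ x)
  simp only [σ.symm_apply_apply] at h3 ⊢
  split_ifs <;> simp_all

theorem aux_free_ext {Γ : Type*} [Group Γ] [Countable Γ]
    (α : Γ →* (Cantor ≃ₜ Cantor)) (hα : ∀ x : Cantor, Dense (Set.range fun γ : Γ => α γ x))
    (γ : Γ) (hγ : γ ≠ 1) (m : ℕ) :
    ∃ β : Γ →* (Cantor ≃ₜ Cantor), (∀ x : Cantor, Dense (Set.range fun γ : Γ => β γ x)) ∧
      AuxNear α β m ∧ ∀ x, β γ x ≠ x := by
  obtain ⟨c₀, hc₀⟩ := aux_color (Equiv.mulLeft γ) (fun x => by simpa using hγ)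
  obtain ⟨β, hβ, π, c, -, -, hM, hπ, hcβ, hm⟩ := aux_ext2 α hα
    {p : Cantor × (Γ → Fin 3) | ∀ g, p.2 (γ * g) ≠ p.2 g} (by
      simp only [setOf_forall]
      refine isClosed_iInter fun g => ?_
      have : Continuous fun p : Cantor × (Γ → Fin 3) => (p.2 (γ * g), p.2 g) :=
        ((continuous_apply _).comp continuous_snd).prodMk
          ((continuous_apply _).comp continuous_snd)
      exact (isClosed_discrete {q : Fin 3 × Fin 3 | q.1 ≠ q.2}).preimage this)
    ⟨(fun _ => true, c₀), hc₀⟩ (fun δ x u h g => by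
      have := h (g * δ)
      simpa only [mul_assoc] using this) m
  refine ⟨β, hβ, ⟨π, hπ, hm⟩, fun x hx => ?_⟩
  have h1 := hcβ γ x 1
  rw [hx, one_mul] at h1
  have h2 := hM x 1
  simp only [mul_one] at h2
  exact h2 h1.symm

theorem aux_tendsto {Γ : Type*} [Group Γ] (α : Γ →* (Cantor ≃ₜ Cantor))
    (β : ℕ → (Γ →* (Cantor ≃ₜ Cantor))) (h : ∀ m, AuxNear α (β m) m) :
    Filter.Tendsto β Filter.atTop (@nhds _ (actionTop Γ Cantor) α) := by
  letI := homeoTop Cantor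
  unfold actionTop
  rw [nhds_induced, Filter.tendsto_comap_iff, tendsto_pi_nhds]
  intro γ
  refine TopologicalSpace.tendsto_nhds_generateFrom_iff.2 ?_
  rintro _ ⟨A, B, hA, hB, rfl⟩ hAB
  obtain ⟨a, ha⟩ := aux_dep_set hA
  obtain ⟨b, hb⟩ := aux_dep_set hB
  filter_upwards [Filter.eventually_ge_atTop (max a b)] with m hm
  obtain ⟨π, hπ, hπm⟩ := h m
  have hA' : ∀ x, π x ∈ A ↔ x ∈ A := fun x => ha _ _ fun i hi =>
    hπm x i (lt_of_lt_of_le hi ((le_max_left _ _).trans hm))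
  have hB' : ∀ x, π x ∈ B ↔ x ∈ B := fun x => hb _ _ fun i hi =>
    hπm x i (lt_of_lt_of_le hi ((le_max_right _ _).trans hm))
  change (α γ) '' A = B at hAB
  change (β m γ) '' A = B
  ext y
  constructor
  · rintro ⟨x, hx, rfl⟩
    rw [← hB', hπ, ← hAB]
    exact mem_image_of_mem _ ((hA' x).2 hx)
  · intro hy
    obtain ⟨x, rfl⟩ := (β m γ).surjective y
    rw [← hB', hπ, ← hAB, (α γ).injective.mem_set_image, hA'] at hy
    exact mem_image_of_mem _ hy

theorem aux_open {Γ : Type*} [Group Γ] {X : Type*} [TopologicalSpace X] (γ : Γ) {A : Set X}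
    (hA : IsClopen A) (B : Set X) :
    @IsOpen _ (actionTop Γ X) {α : Γ →* (X ≃ₜ X) | (α γ) '' A = B} := by
  letI := homeoTop X
  letI := actionTop Γ X
  by_cases hB : IsClopen B
  · have h1 : IsOpen {g : X ≃ₜ X | ⇑g '' A = B} :=
      TopologicalSpace.isOpen_generateFrom_of_mem ⟨A, B, hA, hB, rfl⟩
    have h2 : Continuous fun α : Γ →* (X ≃ₜ X) => α γ :=
      (continuous_apply γ).comp continuous_induced_dom
    exact h1.preimage h2
  · have : {α : Γ →* (X ≃ₜ X) | (α γ) '' A = B} = ∅ := ?_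
    · rw [this]; exact isOpen_empty
    rw [eq_empty_iff_forall_notMem]
    intro α h
    apply hB
    rw [← (h : (α γ) '' A = B)]
    exact ⟨(α γ).isClosed_image.2 hA.1, (α γ).isOpen_image.2 hA.2⟩

theorem aux_actC_eventually {Γ : Type*} [Group Γ] {X : Type*} [TopologicalSpace X]
    [CompactSpace X] (α : Γ →* (X ≃ₜ X)) (γ : Γ) (h : C(X, ℕ)) :
    ∀ᶠ β in @nhds _ (actionTop Γ X) α, actC β γ h = actC α γ h := by
  letI := actionTop Γ X
  have hfin : (range h).Finite := (isCompact_range h.continuous).finite_of_discrete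
  have h1 : ∀ v ∈ range h, ∀ᶠ β : Γ →* (X ≃ₜ X) in nhds α,
      (β γ) '' (h ⁻¹' {v}) = (α γ) '' (h ⁻¹' {v}) := by
    intro v _
    exact (aux_open γ ((isClopen_discrete {v}).preimage h.continuous) _).mem_nhds rfl
  filter_upwards [(Filter.eventually_all_finite hfin).2 h1] with β hβ
  have hinv : ∀ (β : Γ →* (X ≃ₜ X)) y, β γ⁻¹ (β γ y) = y := by
    intro β y
    have : β γ⁻¹ (β γ y) = (β γ⁻¹ * β γ) y := rfl
    rw [this, ← map_mul, inv_mul_cancel, map_one]; rfl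
  ext x
  change h (β γ⁻¹ x) = h (α γ⁻¹ x)
  obtain ⟨y, rfl⟩ := (β γ).surjective x
  rw [hinv]
  have : β γ y ∈ (α γ) '' (h ⁻¹' {h y}) := by
    rw [← hβ (h y) ⟨y, rfl⟩]
    exact mem_image_of_mem _ rfl
  obtain ⟨z, hz, hzy⟩ := this
  rw [← hzy, hinv]
  exact hz.symm

theorem aux_typeCon_eventually {Γ : Type*} [Group Γ] {X : Type*} [TopologicalSpace X]
    [CompactSpace X] (α : Γ →* (X ≃ₜ X)) (f g : C(X, ℕ)) (h : typeCon α f g) :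
    ∀ᶠ β in @nhds _ (actionTop Γ X) α, typeCon β f g := by
  letI := actionTop Γ X
  change AddConGen.Rel _ f g at h
  induction h with
  | of f g h =>
    obtain ⟨n, h, γ, hf, hg⟩ := h
    filter_upwards [Filter.eventually_all.2 fun i => aux_actC_eventually α (γ i) (h i)] with β hβ
    refine AddConGen.Rel.of _ _ ⟨n, h, γ, hf, ?_⟩
    rw [hg]
    exact Finset.sum_congr rfl fun i _ => (hβ i).symm
  | refl x => exact Filter.Eventually.of_forall fun β => (typeCon β).refl x
  | symm _ ih => filter_upwards [ih] with β h using (typeCon β).symm h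
  | trans _ _ ih ih' => filter_upwards [ih, ih'] with β h h' using (typeCon β).trans h h'
  | add _ _ ih ih' => filter_upwards [ih, ih'] with β h h' using (typeCon β).add h h'

theorem aux_residual {Y ι : Type*} [TopologicalSpace Y] [Countable ι] (P Q : ι → Set Y)
    (hQ : ∀ i, IsOpen (Q i)) (hPQ : ∀ i, P i ⊆ closure (Q i)) :
    {y | ∀ i, y ∈ P i → y ∈ Q i} ∈ residual Y := by
  have : ∀ i, Q i ∪ (closure (Q i))ᶜ ∈ residual Y := by
    intro i
    refine residual_of_dense_open ((hQ i).union isClosed_closure.isOpen_compl) ?_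
    intro y
    by_cases hy : y ∈ closure (Q i)
    · exact closure_mono subset_union_left hy
    · exact subset_closure (Or.inr hy)
  refine Filter.mem_of_superset (countable_iInter_mem.2 this) ?_
  intro y hy i hP
  rcases mem_iInter.1 hy i with h | h
  · exact h
  · exact absurd (hPQ i hP) h

theorem aux_closure {Γ : Type*} [Group Γ] 
    (Q : Set (Γ →* (Cantor ≃ₜ Cantor)))
    (α : {α : Γ →* (Cantor ≃ₜ Cantor) // ∀ x : Cantor, Dense (Set.range fun γ : Γ => α γ x)})
    (h : ∀ m, ∃ β : Γ →* (Cantor ≃ₜ Cantor),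
      (∀ x : Cantor, Dense (Set.range fun γ : Γ => β γ x)) ∧ AuxNear α.1 β m ∧ β ∈ Q) :
    letI := actionTop Γ Cantor
    α ∈ closure {α : {α : Γ →* (Cantor ≃ₜ Cantor) //
      ∀ x : Cantor, Dense (Set.range fun γ : Γ => α γ x)} | α.1 ∈ Q} := by
  letI := actionTop Γ Cantor
  choose β hβ hn hQ using h
  have : Filter.Tendsto (fun m => (⟨β m, hβ m⟩ : {α : Γ →* (Cantor ≃ₜ Cantor) //
      ∀ x : Cantor, Dense (Set.range fun γ : Γ => α γ x)})) Filter.atTop (nhds α) := by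
    rw [tendsto_subtype_rng]
    exact aux_tendsto α.1 β hn
  exact mem_closure_of_tendsto this (Filter.Eventually.of_forall hQ)

theorem aux_free_open {Γ : Type*} [Group Γ] (γ : Γ) :
    @IsOpen _ (actionTop Γ Cantor) {α : Γ →* (Cantor ≃ₜ Cantor) | ∀ x, α γ x ≠ x} := by
  letI := actionTop Γ Cantor
  rw [isOpen_iff_mem_nhds]
  intro α hα
  have h1 : ∀ x : Cantor, ∃ C : Set Cantor, IsClopen C ∧ x ∈ C ∧ Disjoint ((α γ) '' C) C := by
    intro x
    obtain ⟨U, hU, h1, h2⟩ := exists_isClopen_of_totally_separated (hα x)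
    refine ⟨Uᶜ ∩ (α γ) ⁻¹' U, hU.compl.inter (hU.preimage (α γ).continuous), ⟨h2, h1⟩, ?_⟩
    rw [disjoint_left]
    rintro _ ⟨y, hy, rfl⟩ hy'
    exact hy'.1 hy.2
  choose C hC hx hd using h1
  obtain ⟨t, ht⟩ := isCompact_univ.elim_finite_subcover C (fun x => (hC x).isOpen)
    (fun x _ => mem_iUnion.2 ⟨x, hx x⟩)
  have h2 : ∀ x ∈ t, ∀ᶠ β : Γ →* (Cantor ≃ₜ Cantor) in nhds α, (β γ) '' (C x) = (α γ) '' (C x) :=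
    fun x _ => (aux_open γ (hC x) _).mem_nhds rfl
  filter_upwards [(Filter.eventually_all_finset t).2 h2] with β hβ
  intro y hy
  obtain ⟨x, hxt, hyx⟩ := mem_iUnion₂.1 (ht (mem_univ y))
  have hyα : y ∈ (α γ) '' (C x) := by
    rw [← hβ x hxt]
    exact ⟨y, hyx, hy⟩
  exact Set.disjoint_left.1 (hd x) hyα hyx

theorem aux_le_open {Γ : Type*} [Group Γ] (f g : C(Cantor, ℕ)) :
    @IsOpen _ (actionTop Γ Cantor) {α : Γ →* (Cantor ≃ₜ Cantor) | ∃ h, typeCon α (f + h) g} := by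
  letI := actionTop Γ Cantor
  rw [isOpen_iff_mem_nhds]
  rintro α ⟨h, hα⟩
  filter_upwards [aux_typeCon_eventually α _ _ hα] with β hβ using ⟨h, hβ⟩

theorem aux_eq_open {Γ : Type*} [Group Γ] (f g : C(Cantor, ℕ)) :
    @IsOpen _ (actionTop Γ Cantor) {α : Γ →* (Cantor ≃ₜ Cantor) | typeCon α f g} := by
  letI := actionTop Γ Cantor
  rw [isOpen_iff_mem_nhds]
  intro α hα
  exact aux_typeCon_eventually α _ _ hα

theorem aux_BI_of_le {Γ : Type*} [Group Γ] (α : Γ →* (Cantor ≃ₜ Cantor)) {f g : C(Cantor, ℕ)}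
    (h : ∃ h, typeCon α (f + h) g) : ∃ K : Set Γ, K.Finite ∧ ∀ x,
      ∃ e, AuxBI K (fun γ => f (α γ x)) (fun γ => g (α γ x)) e := by
  obtain ⟨h, hh⟩ := h
  obtain ⟨K, hK, H⟩ := aux_typeCon_le α hh
  exact ⟨K, hK, fun x => aux_BI_of_add (C := fun γ => h (α γ x)) (H x)⟩

theorem aux_tle_iff {Γ : Type*} [Group Γ] (α : Γ →* (Cantor ≃ₜ Cantor)) (f g : C(Cantor, ℕ)) :
    tle α (f : TypeSemigroup α) (g : TypeSemigroup α) ↔ ∃ h, typeCon α (f + h) g := by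
  constructor
  · rintro ⟨c, hc⟩
    induction c using AddCon.induction_on with
    | H h =>
      rw [← AddCon.coe_add, AddCon.eq] at hc
      exact ⟨h, hc⟩
  · rintro ⟨h, hh⟩
    refine ⟨(h : TypeSemigroup α), ?_⟩
    rw [← AddCon.coe_add, AddCon.eq]
    exact hh

theorem stmt15 (Γ : Type*) [Group Γ] [Countable Γ] [Infinite Γ] :
    letI := actionTop Γ Cantor
    {α : {α : Γ →* (Cantor ≃ₜ Cantor) //
            ∀ x : Cantor, Dense (Set.range fun γ : Γ => α γ x)} |
        (∀ (γ : Γ) (x : Cantor), α.1 γ x = x → γ = 1) ∧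
        IsUnperforated α.1 ∧ TleAntisymm α.1} ∈
      residual {α : Γ →* (Cantor ≃ₜ Cantor) //
            ∀ x : Cantor, Dense (Set.range fun γ : Γ => α γ x)} := by
  letI := actionTop Γ Cantor
  have := aux_countable
  let Y := {α : Γ →* (Cantor ≃ₜ Cantor) //
            ∀ x : Cantor, Dense (Set.range fun γ : Γ => α γ x)}
  have R1 := aux_residual (Y := Y) (ι := {γ : Γ // γ ≠ 1}) (fun _ => univ)
    (fun γ => {α | ∀ x, α.1 γ.1 x ≠ x})
    (fun γ => (aux_free_open γ.1).preimage continuous_subtype_val)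
    (fun γ α _ => aux_closure {α | ∀ x, α γ.1 x ≠ x} α fun m =>
      aux_free_ext α.1 α.2 γ.1 γ.2 m)
  have R2 := aux_residual (Y := Y) (ι := C(Cantor, ℕ) × C(Cantor, ℕ) × ℕ)
    (fun i => {α | 1 ≤ i.2.2 ∧ ∃ h, typeCon α.1 (i.2.2 • i.1 + h) (i.2.2 • i.2.1)})
    (fun i => {α | ∃ h, typeCon α.1 (i.1 + h) i.2.1})
    (fun i => (aux_le_open i.1 i.2.1).preimage continuous_subtype_val) (by
      rintro ⟨f, g, n⟩ α ⟨hn, hα⟩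
      refine aux_closure {α | ∃ h, typeCon α (f + h) g} α fun m => ?_
      obtain ⟨K, hK, H⟩ := aux_BI_of_le α.1 hα
      obtain ⟨e, he⟩ := aux_hall (F := fun γ => f (α.1 γ fun _ => true))
        (G := fun γ => g (α.1 γ fun _ => true)) (n := n) hK hn (by
          have hcomm : ∀ f : C(Cantor, ℕ), (fun γ => f (α.1 γ fun _ => true) * n) =
              fun γ => (n • f) (α.1 γ fun _ => true) := fun f => funext fun γ => mul_comm _ _
          have key : ∀ F' G' F G : Γ → ℕ, F' = F → G' = G →
              (∃ e, AuxBI K F' G' e) → ∃ e, AuxBI K F G e := by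
            rintro _ _ _ _ rfl rfl h
            exact h
          exact key _ _ _ _ (hcomm f).symm (hcomm g).symm (H fun _ => true))
      obtain ⟨β, hβ, hnear, g', h1, h2, -⟩ :=
        aux_flow_ext α.1 α.2 f g K hK False (fun _ => true) ⟨e, he, False.elim⟩ m
      refine ⟨β, hβ, hnear, ⟨fun x => g x - g' x, g.continuous.sub g'.continuous⟩, ?_⟩
      have h3 := (typeCon β).add h1
        ((typeCon β).refl ⟨fun x => g x - g' x, g.continuous.sub g'.continuous⟩)
      convert h3 using 1
      ext x
      have : g' x ≤ g x := h2 x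
      change g x = g' x + (g x - g' x)
      omega)
  have R3 := aux_residual (Y := Y) (ι := C(Cantor, ℕ) × C(Cantor, ℕ))
    (fun i => {α | (∃ h, typeCon α.1 (i.1 + h) i.2) ∧ ∃ h, typeCon α.1 (i.2 + h) i.1})
    (fun i => {α | typeCon α.1 i.1 i.2})
    (fun i => (aux_eq_open i.1 i.2).preimage continuous_subtype_val) (by
      rintro ⟨f, g⟩ α ⟨h1, h2⟩
      refine aux_closure {α | typeCon α f g} α fun m => ?_
      obtain ⟨K, hK, H⟩ := aux_BI_of_le α.1 h1
      obtain ⟨L, hL, H'⟩ := aux_BI_of_le α.1 h2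
      obtain ⟨e, ei, he⟩ := H fun _ => true
      obtain ⟨e', ei', he'⟩ := H' fun _ => true
      obtain ⟨k, hk, hkK⟩ := Function.Embedding.schroeder_bernstein_of_rel ei ei'
        (fun p q => q.1 * p.1⁻¹ ∈ K ∪ L⁻¹) (fun p => Or.inl (he p))
        (fun q => Or.inr (by simpa using he' q))
      obtain ⟨β, hβ, hnear, g', h1, -, h3⟩ :=
        aux_flow_ext α.1 α.2 f g (K ∪ L⁻¹) (hK.union hL.inv) True (fun _ => true)
          ⟨k, ⟨hk.1, hkK⟩, fun _ => hk.2⟩ m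
      refine ⟨β, hβ, hnear, ?_⟩
      rw [h3 trivial] at h1
      exact h1)
  filter_upwards [R1, R2, R3] with α h1 h2 h3
  refine ⟨fun γ x hx => ?_, ?_, ?_⟩
  · by_contra hγ
    exact h1 ⟨γ, hγ⟩ trivial x hx
  · intro a b n hn
    induction a using AddCon.induction_on with
    | H f =>
    induction b using AddCon.induction_on with
    | H g =>
    intro h
    rw [aux_tle_iff]
    refine h2 (f, g, n) ⟨hn, ?_⟩
    rw [← aux_tle_iff]
    exact h
  · intro a b
    induction a using AddCon.induction_on with
    | H f =>
    induction b using AddCon.induction_on with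
    | H g =>
    intro h h'
    rw [aux_tle_iff] at h h'
    rw [AddCon.eq]
    exact h3 (f, g) ⟨h, h'⟩
end

section
/- Let Γ be an infinite countable group. There exists α ∈ A(Γ) whose conjugacy class {h ∘ α ∘ h⁻¹ : h ∈ Homeo(X)} (where (h ∘ α ∘ h⁻¹)(γ) = h ∘ α(γ) ∘ h⁻¹) is dense in A(Γ), and there exists β ∈ Min(Γ) whose conjugacy class is dense in Min(Γ). -/
open MeasureTheory Set
open scoped ENNReal

theorem split_exists {Z : Type*} [TopologicalSpace Z] [CompactSpace Z] [T2Space Z]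
    [TotallyDisconnectedSpace Z] (hp : ∀ z : Z, ¬ IsOpen ({z} : Set Z)) (C : Set Z)
    (hC : IsClopen C) (P : Set Z) (hP : IsClopen P) (hne : P.Nonempty) :
    ∃ Q : Set Z, IsClopen Q ∧ Q ⊆ P ∧ Q.Nonempty ∧ (P \ Q).Nonempty ∧
      (P ⊆ C ∨ Disjoint P C ∨ Q = P ∩ C) := by
  by_cases h : (P ∩ C).Nonempty ∧ (P \ C).Nonempty
  · refine ⟨P ∩ C, hP.inter hC, inter_subset_left, h.1, ?_, Or.inr (Or.inr rfl)⟩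
    simpa using h.2
  · have h' : P ⊆ C ∨ Disjoint P C := by
      by_cases h1 : (P ∩ C).Nonempty
      · left
        have : ¬ (P \ C).Nonempty := fun h2 => h ⟨h1, h2⟩
        rwa [Set.not_nonempty_iff_eq_empty, Set.sdiff_eq_empty] at this
      · right
        rwa [Set.disjoint_iff_inter_eq_empty, ← Set.not_nonempty_iff_eq_empty]
    obtain ⟨z, hz⟩ := hne
    have : ∃ w ∈ P, w ≠ z := by
      by_contra hcon
      push Not at hcon
      apply hp z
      have : P = {z} := Set.eq_singleton_iff_unique_mem.2 ⟨hz, hcon⟩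
      exact this ▸ hP.2
    obtain ⟨w, hw, hwz⟩ := this
    obtain ⟨V, hV, hzV, hVU⟩ := compact_exists_isClopen_in_isOpen (x := z) (U := {w}ᶜ)
      isOpen_compl_singleton (by simpa using hwz.symm)
    refine ⟨P ∩ V, hP.inter hV, inter_subset_left, ⟨z, hz, hzV⟩, ⟨w, hw, fun h => ?_⟩, ?_⟩
    · exact hVU h.2 rfl
    · rcases h' with h' | h'
      · exact Or.inl h'
      · exact Or.inr (Or.inl h')

/-- The tree of pieces. -/
noncomputable def pieces {Z : Type*} (Q : ℕ → Set Z → Set Z) (x : ℕ → Bool) : ℕ → Set Z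
  | 0 => Set.univ
  | n + 1 => if x n = true then Q n (pieces Q x n) else pieces Q x n \ Q n (pieces Q x n)

/-- The coding map. -/
noncomputable def codePiece {Z : Type*} (Q : ℕ → Set Z → Set Z) (z : Z) : ℕ → Set Z
  | 0 => Set.univ
  | n + 1 => open Classical in if z ∈ Q n (codePiece Q z n) then Q n (codePiece Q z n)
      else codePiece Q z n \ Q n (codePiece Q z n)

theorem brouwer_cantor {Z : Type*} [TopologicalSpace Z] [CompactSpace Z] [T2Space Z]
    [SecondCountableTopology Z] [TotallyDisconnectedSpace Z] [Nonempty Z]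
    (hp : ∀ z : Z, ¬ IsOpen ({z} : Set Z)) : Nonempty (Z ≃ₜ (ℕ → Bool)) := by
  classical
  have hcount : Countable (TopologicalSpace.Clopens Z) :=
    TopologicalSpace.Clopens.countable_iff_secondCountable.2 inferInstance
  obtain ⟨C, hC⟩ := exists_surjective_nat (TopologicalSpace.Clopens Z)
  have key : ∀ (n : ℕ) (P : Set Z), ∃ Q : Set Z, IsClopen P → P.Nonempty →
      IsClopen Q ∧ Q ⊆ P ∧ Q.Nonempty ∧ (P \ Q).Nonempty ∧
      (P ⊆ (C n : Set Z) ∨ Disjoint P (C n : Set Z) ∨ Q = P ∩ (C n : Set Z)) := by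
    intro n P
    by_cases h : IsClopen P ∧ P.Nonempty
    · obtain ⟨Q, hQ⟩ := split_exists hp (C n : Set Z) (C n).isClopen P h.1 h.2
      exact ⟨Q, fun _ _ => hQ⟩
    · exact ⟨∅, fun h1 h2 => absurd ⟨h1, h2⟩ h⟩
  choose Q hQ using key
  have hD : ∀ x n, IsClopen (pieces Q x n) ∧ (pieces Q x n).Nonempty := by
    intro x n
    induction n with
    | zero => exact ⟨isClopen_univ, Set.univ_nonempty⟩
    | succ n ih =>
      obtain ⟨h1, h2, h3, h4, -⟩ := hQ n _ ih.1 ih.2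
      simp only [pieces]
      split_ifs
      · exact ⟨h1, h3⟩
      · exact ⟨ih.1.diff h1, h4⟩
  let f : Z → ℕ → Bool := fun z n => decide (z ∈ Q n (codePiece Q z n))
  have hfp : ∀ z n, pieces Q (f z) n = codePiece Q z n := by
    intro z n
    induction n with
    | zero => rfl
    | succ n ih =>
      simp only [pieces, codePiece, ih, f, decide_eq_true_eq]
  have hmem : ∀ z n, z ∈ codePiece Q z n := by
    intro z n
    induction n with
    | zero => exact Set.mem_univ _
    | succ n ih =>
      simp only [codePiece]
      split_ifs with h
      · exact h
      · exact ⟨ih, h⟩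
  have hclop : ∀ z n, IsClopen (codePiece Q z n) ∧ (codePiece Q z n).Nonempty := fun z n => by
    rw [← hfp]; exact hD _ _
  -- uniqueness
  have huniq : ∀ x z, (∀ n, z ∈ pieces Q x n) → f z = x := by
    intro x z h
    have : ∀ n, pieces Q x n = codePiece Q z n ∧ f z n = x n := by
      have step : ∀ n, pieces Q x n = codePiece Q z n → f z n = x n := by
        intro n hn
        have h1 := h (n + 1)
        simp only [pieces, hn] at h1
        simp only [f]
        cases hx : x n with
        | true => simpa [hx] using h1
        | false =>
          simp only [hx] at h1
          simpa using h1.2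
      intro n
      induction n with
      | zero => exact ⟨rfl, step 0 rfl⟩
      | succ n ih =>
        have : pieces Q x (n + 1) = codePiece Q z (n + 1) := by
          rw [← hfp]
          simp only [pieces]
          rw [hfp, ih.1, ih.2]
        exact ⟨this, step _ this⟩
    exact funext fun n => (this n).2
  have hanti : ∀ x n, pieces Q x (n + 1) ⊆ pieces Q x n := by
    intro x n
    obtain ⟨h1, h2, -⟩ := hQ n _ (hD x n).1 (hD x n).2
    simp only [pieces]
    split_ifs
    · exact h2
    · exact Set.sdiff_subset
  have hsurj : Function.Surjective f := by
    intro x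
    have := IsCompact.nonempty_iInter_of_sequence_nonempty_isCompact_isClosed (pieces Q x)
      (hanti x) (fun n => (hD x n).2) (hD x 0).1.1.isCompact (fun n => (hD x n).1.1)
    obtain ⟨z, hz⟩ := this
    exact ⟨z, huniq x z (Set.mem_iInter.1 hz)⟩
  have hinj : Function.Injective f := by
    intro z w hzw
    by_contra hne
    obtain ⟨V, hV, hzV, hVU⟩ := compact_exists_isClopen_in_isOpen (x := z) (U := {w}ᶜ)
      isOpen_compl_singleton (by simpa using hne)
    have hwV : w ∉ V := fun h => hVU h rfl
    obtain ⟨n, hn⟩ := hC ⟨V, hV⟩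
    have hCn : (C n : Set Z) = V := by rw [hn]; rfl
    have hz := hmem z n
    have hw := hmem w n
    have e : codePiece Q w n = codePiece Q z n := by rw [← hfp, ← hfp, hzw]
    rw [e] at hw
    obtain ⟨-, -, -, -, h⟩ := hQ n _ (hclop z n).1 (hclop z n).2
    rw [hCn] at h
    rcases h with h | h | h
    · exact hwV (h hw)
    · exact Set.disjoint_left.1 h hz hzV
    · have h1 : f z n = true := by simp only [f, h, decide_eq_true_eq]; exact ⟨hz, hzV⟩
      have h2 : f w n = false := by
        simp only [f, e, h, decide_eq_false_iff_not]; exact fun h => hwV h.2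
      rw [hzw, h2] at h1
      exact Bool.noConfusion h1
  have hcodeeq : ∀ n z w, w ∈ codePiece Q z n → codePiece Q w n = codePiece Q z n := by
    intro n
    induction n with
    | zero => intro z w _; rfl
    | succ n ih =>
      intro z w hw
      have hsub : codePiece Q z (n + 1) ⊆ codePiece Q z n := by
        rw [← hfp, ← hfp]; exact hanti _ _
      have e := ih z w (hsub hw)
      simp only [codePiece] at hw ⊢
      rw [e]
      by_cases h : z ∈ Q n (codePiece Q z n)
      · rw [if_pos h] at hw
        rw [if_pos h, if_pos hw]
      · rw [if_neg h] at hw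
        rw [if_neg h, if_neg hw.2]
  have hcont : Continuous f := by
    refine continuous_pi fun n => ?_
    refine IsLocallyConstant.continuous ?_
    rw [IsLocallyConstant.iff_eventually_eq]
    intro z
    filter_upwards [(hclop z (n + 1)).1.2.mem_nhds (hmem z (n + 1))] with w hw
    have e1 := hcodeeq _ _ _ hw
    have hsub : codePiece Q z (n + 1) ⊆ codePiece Q z n := by
      rw [← hfp, ← hfp]; exact hanti _ _
    have e := hcodeeq _ _ _ (hsub hw)
    simp only [f, e]
    simp only [codePiece] at hw
    by_cases h : z ∈ Q n (codePiece Q z n)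
    · rw [if_pos h] at hw
      simp [h, hw]
    · rw [if_neg h] at hw
      simp [h, hw.2]
  exact ⟨Continuous.homeoOfEquivCompactToT2 (f := Equiv.ofBijective f ⟨hinj, hsurj⟩) hcont⟩

theorem cantor_no_isolated (x : ℕ → Bool) : ¬ IsOpen ({x} : Set (ℕ → Bool)) := by
  intro h
  have ht : Filter.Tendsto (fun n : ℕ => Function.update x n (!x n)) Filter.atTop (nhds x) := by
    rw [tendsto_pi_nhds]
    intro k
    refine tendsto_const_nhds.congr' ?_
    filter_upwards [Filter.eventually_gt_atTop k] with n hn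
    rw [Function.update_of_ne hn.ne]
  have := ht.eventually (h.mem_nhds rfl)
  obtain ⟨n, hn⟩ := this.exists
  have := congrFun (Set.mem_singleton_iff.1 hn) n
  simp at this

theorem clopen_cantor {Z : Type*} [TopologicalSpace Z] [CompactSpace Z] [T2Space Z]
    [SecondCountableTopology Z] [TotallyDisconnectedSpace Z]
    (hp : ∀ z : Z, ¬ IsOpen ({z} : Set Z)) (s : Set Z) (hs : IsClopen s) (hne : s.Nonempty) :
    Nonempty (s ≃ₜ (ℕ → Bool)) := by
  have : CompactSpace s := isCompact_iff_compactSpace.1 hs.1.isCompact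
  have : Nonempty s := hne.to_subtype
  apply brouwer_cantor
  intro z hz
  apply hp z.1
  have := hs.2.isOpenMap_subtype_val _ hz
  simpa using this

/-- Fibres decomposition. -/
theorem exists_homeo_of_labels {T : Type*} [Finite T] (f g : (ℕ → Bool) → T)
    (hf : IsLocallyConstant f) (hg : IsLocallyConstant g) (hr : Set.range f = Set.range g) :
    ∃ h : (ℕ → Bool) ≃ₜ (ℕ → Bool), ∀ x, f (h x) = g x := by
  have hcl : ∀ (k : (ℕ → Bool) → T), IsLocallyConstant k → ∀ t, IsClopen {x | k x = t} := by
    intro k hk t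
    exact hk.isClopen_fiber t
  have hfib : ∀ t, Nonempty ({x // g x = t} ≃ₜ {x // f x = t}) := by
    intro t
    by_cases ht : t ∈ Set.range g
    · have ht' : t ∈ Set.range f := hr ▸ ht
      obtain ⟨e1⟩ := clopen_cantor cantor_no_isolated _ (hcl g hg t) ht
      obtain ⟨e2⟩ := clopen_cantor cantor_no_isolated _ (hcl f hf t) ht'
      exact ⟨e1.trans e2.symm⟩
    · have ht' : t ∉ Set.range f := hr ▸ ht
      have : IsEmpty {x // g x = t} := ⟨fun x => ht ⟨x.1, x.2⟩⟩
      have : IsEmpty {x // f x = t} := ⟨fun x => ht' ⟨x.1, x.2⟩⟩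
      exact ⟨⟨Equiv.equivOfIsEmpty _ _, by fun_prop, by fun_prop⟩⟩
  let e := fun t => (hfib t).some
  have hcomp : ∀ (k : (ℕ → Bool) → T), IsLocallyConstant k →
      ∃ E : (Σ t, {x // k x = t}) ≃ₜ (ℕ → Bool), ∀ p, E p = p.2.1 := by
    intro k hk
    have : ∀ t, CompactSpace {x // k x = t} := fun t =>
      isCompact_iff_compactSpace.1 (hcl k hk t).1.isCompact
    have hc : Continuous (Equiv.sigmaFiberEquiv k) := by
      refine continuous_sigma fun t => ?_
      exact continuous_subtype_val
    exact ⟨hc.homeoOfEquivCompactToT2, fun p => rfl⟩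
  obtain ⟨E1, hE1⟩ := hcomp g hg
  obtain ⟨E2, hE2⟩ := hcomp f hf
  let M : (Σ t, {x // g x = t}) ≃ₜ (Σ t, {x // f x = t}) :=
    { toEquiv := Equiv.sigmaCongrRight fun t => (e t).toEquiv
      continuous_toFun := continuous_sigma fun t => continuous_sigmaMk.comp (e t).continuous
      continuous_invFun := continuous_sigma fun t => continuous_sigmaMk.comp (e t).symm.continuous }
  refine ⟨E1.symm.trans (M.trans E2), fun x => ?_⟩
  obtain ⟨⟨t, p⟩, rfl⟩ := E1.surjective x
  simp only [Homeomorph.trans_apply, Homeomorph.symm_apply_apply, hE2]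
  rw [hE1]
  exact ((e t) p).2.trans p.2.symm

/-- Build an action by homeomorphisms from continuous maps. -/
def mkAct {Γ : Type*} [Group Γ] {Z : Type*} [TopologicalSpace Z] (a : Γ → Z → Z)
    (h1 : ∀ z, a 1 z = z) (hm : ∀ g k z, a (g * k) z = a g (a k z))
    (hc : ∀ g, Continuous (a g)) : Γ →* (Z ≃ₜ Z) where
  toFun g :=
    { toFun := a g
      invFun := a g⁻¹
      left_inv := fun z => by rw [← hm, inv_mul_cancel, h1]
      right_inv := fun z => by rw [← hm, mul_inv_cancel, h1]
      continuous_toFun := hc g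
      continuous_invFun := hc g⁻¹ }
  map_one' := Homeomorph.ext fun z => h1 z
  map_mul' g k := Homeomorph.ext fun z => hm g k z

theorem act_one {Γ : Type*} [Group Γ] {Z : Type*} [TopologicalSpace Z] (α : Γ →* (Z ≃ₜ Z)) (z : Z) :
    α 1 z = z := by rw [map_one]; rfl

theorem act_mul {Γ : Type*} [Group Γ] {Z : Type*} [TopologicalSpace Z] (α : Γ →* (Z ≃ₜ Z))
    (g k : Γ) (z : Z) : α (g * k) z = α g (α k z) := by rw [map_mul]; rfl

/-- Conjugate action. -/
def conjAct {Γ : Type*} [Group Γ] {Y Z : Type*} [TopologicalSpace Y] [TopologicalSpace Z]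
    (h : Y ≃ₜ Z) (α : Γ →* (Y ≃ₜ Y)) : Γ →* (Z ≃ₜ Z) :=
  mkAct (fun g z => h (α g (h.symm z))) (fun z => by simp [act_one])
    (fun g k z => by simp [act_mul]) (fun g => by fun_prop)

theorem exists_minimal_set {Γ : Type*} {Z : Type*} [TopologicalSpace Z]
    [CompactSpace Z] (a : Γ → Z → Z) (W : Set Z) (hW : IsClosed W)
    (hne : W.Nonempty) (hinv : ∀ g, ∀ x ∈ W, a g x ∈ W) :
    ∃ M ⊆ W, IsClosed M ∧ M.Nonempty ∧ (∀ g, ∀ x ∈ M, a g x ∈ M) ∧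
      ∀ N ⊆ M, IsClosed N → N.Nonempty → (∀ g, ∀ x ∈ N, a g x ∈ N) → N = M := by
  obtain ⟨M, hMW, hM⟩ := zorn_superset_nonempty
    {N : Set Z | IsClosed N ∧ N.Nonempty ∧ ∀ g, ∀ x ∈ N, a g x ∈ N} (by
      intro c hc hchain hcne
      refine ⟨⋂₀ c, ⟨isClosed_sInter fun t ht => (hc ht).1, ?_, ?_⟩,
        fun s hs => Set.sInter_subset_of_mem hs⟩
      · have : Nonempty c := hcne.to_subtype
        refine IsCompact.nonempty_sInter_of_directed_nonempty_isCompact_isClosed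
          ?_ (fun t ht => (hc ht).2.1) (fun t ht => (hc ht).1.isCompact) (fun t ht => (hc ht).1)
        intro s hs t ht
        rcases hchain.total hs ht with h | h
        · exact ⟨s, hs, subset_rfl, h⟩
        · exact ⟨t, ht, h, subset_rfl⟩
      · intro g x hx t ht
        exact (hc ht).2.2 g x (hx t ht)) W ⟨hW, hne, hinv⟩
  refine ⟨M, hMW, hM.prop.1, hM.prop.2.1, hM.prop.2.2, fun N hN h1 h2 h3 => ?_⟩
  exact Set.Subset.antisymm hN (hM.le_of_le ⟨h1, h2, h3⟩ hN)

theorem conj_minimal {Γ : Type*} [Group Γ] {Y Z : Type*} [TopologicalSpace Y] [TopologicalSpace Z]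
    (h : Y ≃ₜ Z) (β : Γ →* (Y ≃ₜ Y)) (hβ : ∀ x, Dense (Set.range fun γ : Γ => β γ x)) (x : Z) :
    Dense (Set.range fun γ : Γ => conjAct h β γ x) := by
  have := h.surjective.denseRange.dense_image h.continuous (hβ (h.symm x))
  rw [← Set.range_comp] at this
  exact this

/-- Every closed invariant set without finite orbits supports a minimal Cantor system. -/
theorem exists_minimal_cantor {Γ : Type*} [Group Γ] {Z : Type*} [TopologicalSpace Z]
    [CompactSpace Z] [T2Space Z] [SecondCountableTopology Z] [TotallyDisconnectedSpace Z]
    (a : Γ → Z → Z)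
    (h1 : ∀ z, a 1 z = z) (hm : ∀ g k z, a (g * k) z = a g (a k z))
    (hc : ∀ g, Continuous (a g)) (W : Set Z) (hW : IsClosed W)
    (hne : W.Nonempty) (hinv : ∀ g, ∀ x ∈ W, a g x ∈ W)
    (hinf : ∀ x ∈ W, (Set.range fun g => a g x).Infinite) :
    ∃ (β : Γ →* (Cantor ≃ₜ Cantor)) (p : Cantor → Z), Continuous p ∧
      (∀ x : Cantor, Dense (Set.range fun γ : Γ => β γ x)) ∧
      ∀ γ x, p (β γ x) = a γ (p x) := by
  obtain ⟨M, hMW, hMc, hMne, hMinv, hmin⟩ := exists_minimal_set a W hW hne hinv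
  have : CompactSpace M := isCompact_iff_compactSpace.1 hMc.isCompact
  have : Nonempty M := hMne.to_subtype
  let b : Γ →* (M ≃ₜ M) := mkAct (fun g x => ⟨a g x.1, hMinv g x.1 x.2⟩)
    (fun z => Subtype.ext (h1 _)) (fun g k z => Subtype.ext (hm _ _ _))
    (fun g => ((hc g).comp continuous_subtype_val).subtype_mk _)
  have hb : ∀ g x, (b g x).1 = a g x.1 := fun g x => rfl
  have hdense : ∀ x : M, Dense (Set.range fun g : Γ => b g x) := by
    intro x
    have hN : Subtype.val '' closure (Set.range fun g : Γ => b g x) = M := by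
      apply hmin
      · rintro _ ⟨y, -, rfl⟩; exact y.2
      · exact hMc.isClosedEmbedding_subtypeVal.isClosedMap _ isClosed_closure
      · exact ⟨_, _, subset_closure ⟨1, rfl⟩, rfl⟩
      · rintro g _ ⟨y, hy, rfl⟩
        refine ⟨b g y, ?_, rfl⟩
        refine map_mem_closure (b g).continuous hy ?_
        rintro _ ⟨k, rfl⟩
        exact ⟨g * k, act_mul _ _ _ _⟩
    intro y
    have hy : y.1 ∈ Subtype.val '' closure (Set.range fun g : Γ => b g x) := by
      rw [hN]; exact y.2
    obtain ⟨y', hy', e⟩ := hy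
    rwa [← Subtype.ext e]
  have hperf : ∀ z : M, ¬ IsOpen ({z} : Set M) := by
    intro m hm'
    have hall : ∀ x : M, IsOpen ({x} : Set M) := by
      intro x
      obtain ⟨_, hy1, ⟨g, rfl⟩⟩ := (hdense x).inter_open_nonempty _ hm' ⟨m, rfl⟩
      have : ({x} : Set M) = (b g) ⁻¹' {m} := by
        ext y
        simp only [Set.mem_singleton_iff, Set.mem_preimage] at hy1 ⊢
        rw [← hy1]
        exact (b g).injective.eq_iff.symm
      rw [this]
      exact hm'.preimage (b g).continuous
    have : DiscreteTopology M := discreteTopology_iff_isOpen_singleton.2 hall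
    have hfin : Finite M := finite_of_compact_of_discrete
    apply hinf m.1 (hMW m.2)
    have : (Set.range fun g => a g m.1) ⊆ M := by
      rintro _ ⟨g, rfl⟩; exact hMinv g _ m.2
    exact Set.Finite.subset (Set.toFinite M) this
  obtain ⟨e⟩ := brouwer_cantor hperf
  refine ⟨conjAct e b, fun x => (e.symm x).1, by fun_prop, ?_, ?_⟩
  · exact conj_minimal e b hdense
  · intro γ x
    change (e.symm (e (b γ (e.symm x)))).1 = _
    rw [e.symm_apply_apply, hb]

theorem three_coloring {V : Type*} [Countable V] (f : Equiv.Perm V) (hf : ∀ x, f x ≠ x) :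
    ∃ c : V → Fin 3, ∀ x, c (f x) ≠ c x := by
  obtain ⟨ι, hι⟩ := exists_injective_nat V
  have hwf : WellFounded (fun x y : V => ι x < ι y) := InvImage.wf ι wellFounded_lt
  have pick : ∀ a b : Fin 3, ∃ c : Fin 3, c ≠ a ∧ c ≠ b := by decide
  choose pk hpk using pick
  classical
  let F : ∀ x : V, (∀ y : V, ι y < ι x → Fin 3) → Fin 3 := fun x r =>
    pk (if h : ι (f x) < ι x then r (f x) h else 0)
       (if h : ι (f.symm x) < ι x then r (f.symm x) h else 0)
  let c : V → Fin 3 := hwf.fix F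
  have hc : ∀ x, c x = pk (if ι (f x) < ι x then c (f x) else 0)
       (if ι (f.symm x) < ι x then c (f.symm x) else 0) := by
    intro x
    have := hwf.fix_eq F x
    simpa only [F, dite_eq_ite] using this
  refine ⟨c, fun x h => ?_⟩
  rcases lt_trichotomy (ι (f x)) (ι x) with h1 | h1 | h1
  · have := hc x
    rw [if_pos h1] at this
    exact (hpk (c (f x)) _).1 (this.symm.trans h.symm)
  · exact hf x (hι h1)
  · have := hc (f x)
    rw [f.symm_apply_apply, if_pos h1] at this
    exact (hpk _ (c x)).2 (this.symm.trans h)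

theorem exists_min_action (Γ : Type*) [Group Γ] [Countable Γ] [Infinite Γ] :
    ∃ β : Γ →* (Cantor ≃ₜ Cantor), ∀ x : Cantor, Dense (Set.range fun γ : Γ => β γ x) := by
  let a : Γ → (Γ → Γ → Fin 3) → (Γ → Γ → Fin 3) := fun h c g x => c g (x * h)
  let W : Set (Γ → Γ → Fin 3) := {c | ∀ g, g ≠ 1 → ∀ x, c g (g * x) ≠ c g x}
  refine (exists_minimal_cantor a
    (fun z => by funext g x; simp [a]) (fun g k z => by funext u x; simp [a, mul_assoc])
    (fun g => by fun_prop) W ?_ ?_ ?_ ?_).imp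
    fun β ⟨p, _, h, _⟩ => h
  · have : W = ⋂ g, ⋂ (_ : g ≠ 1), ⋂ x, {c : Γ → Γ → Fin 3 | c g (g * x) ≠ c g x} := by
      ext c; simp [W]
    rw [this]
    refine isClosed_iInter fun g => isClosed_iInter fun _ => isClosed_iInter fun x => ?_
    have hcont : Continuous fun c : Γ → Γ → Fin 3 => (c g (g * x), c g x) := by fun_prop
    exact (isClosed_discrete {q : Fin 3 × Fin 3 | q.1 ≠ q.2}).preimage hcont
  · have : ∀ g : Γ, ∃ c : Γ → Fin 3, g ≠ 1 → ∀ x, c (g * x) ≠ c x := by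
      intro g
      by_cases hg : g = 1
      · exact ⟨fun _ => 0, fun h => absurd hg h⟩
      · obtain ⟨c, hc⟩ := three_coloring (Equiv.mulLeft g) (fun x => by simpa using hg)
        exact ⟨c, fun _ x => hc x⟩
    choose c hc using this
    exact ⟨c, hc⟩
  · intro h c hc g hg x
    simp only [a, mul_assoc]
    exact hc g hg _
  · intro c hc
    apply Set.infinite_range_of_injective
    intro g k hgk
    by_contra hne
    have hgk' : ∀ u x, c u (x * g) = c u (x * k) := fun u x => congrFun (congrFun hgk u) x
    have := hc (g * k⁻¹) (by rwa [Ne, mul_inv_eq_one]) k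
    apply this
    have := hgk' (g * k⁻¹) 1
    simpa using this

theorem clopen_countable_cantor : Countable {A : Set Cantor // IsClopen A} := by
  have hcount : Countable (TopologicalSpace.Clopens Cantor) :=
    TopologicalSpace.Clopens.countable_iff_secondCountable.2 inferInstance
  exact Function.Injective.countable (f := fun A : {A : Set Cantor // IsClopen A} =>
    (⟨A.1, A.2⟩ : TopologicalSpace.Clopens Cantor)) fun A B h => by
      apply Subtype.ext
      exact congrArg (fun C : TopologicalSpace.Clopens Cantor => (C : Set Cantor)) h

theorem secondCountable_action (Γ : Type*) [Group Γ] [Countable Γ] :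
    @SecondCountableTopology (Γ →* (Cantor ≃ₜ Cantor)) (actionTop Γ Cantor) := by
  letI := homeoTop Cantor
  have : SecondCountableTopology (Cantor ≃ₜ Cantor) := by
    refine ⟨_, ?_, rfl⟩
    have := clopen_countable_cantor
    refine (Set.countable_range (fun q : {A : Set Cantor // IsClopen A} ×
      {A : Set Cantor // IsClopen A} => {g : Cantor ≃ₜ Cantor | ⇑g '' q.1.1 = q.2.1})).mono ?_
    rintro U ⟨A, B, hA, hB, rfl⟩
    exact ⟨(⟨A, hA⟩, ⟨B, hB⟩), rfl⟩
  exact TopologicalSpace.secondCountableTopology_induced _ _ _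

theorem factor_seq {Γ : Type*} [Group Γ] (α β : Γ →* (Cantor ≃ₜ Cantor)) (π : Cantor → Cantor)
    (hπ : Continuous π) (hs : Function.Surjective π) (he : ∀ γ x, π (β γ x) = α γ (π x)) :
    ∃ h : ℕ → (Cantor ≃ₜ Cantor),
      Filter.Tendsto (fun n => conjAct (h n) β) Filter.atTop (@nhds _ (actionTop Γ Cantor) α) := by
  classical
  have := clopen_countable_cantor
  have : Nonempty {A : Set Cantor // IsClopen A} := ⟨⟨_, isClopen_univ⟩⟩
  obtain ⟨C, hC⟩ := exists_surjective_nat {A : Set Cantor // IsClopen A}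
  have key : ∀ n : ℕ, ∃ h : Cantor ≃ₜ Cantor, ∀ i < n, ∀ x, h x ∈ (C i).1 ↔ π x ∈ (C i).1 := by
    intro n
    let f : Cantor → (Fin n → Prop) := fun x i => x ∈ (C i).1
    have hf : IsLocallyConstant f := by
      rw [IsLocallyConstant.iff_eventually_eq]
      intro x
      have : ∀ i : Fin n, ∀ᶠ y in nhds x, f y i = f x i := by
        intro i
        by_cases hx : x ∈ (C i).1
        · filter_upwards [(C i).2.2.mem_nhds hx] with y hy
          simp [f, hx, hy]
        · filter_upwards [(C i).2.1.isOpen_compl.mem_nhds hx] with y hy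
          simp only [f, eq_iff_iff]
          exact ⟨fun h => absurd h hy, fun h => absurd h hx⟩
      filter_upwards [Filter.eventually_all.2 this] with y hy
      exact funext hy
    obtain ⟨h, hh⟩ := exists_homeo_of_labels f (f ∘ π) hf (hf.comp_continuous hπ)
      (by rw [hs.range_comp])
    refine ⟨h, fun i hi x => ?_⟩
    exact iff_of_eq (congrFun (hh x) ⟨i, hi⟩)
  choose h hh using key
  refine ⟨h, ?_⟩
  have hev : ∀ A : Set Cantor, IsClopen A → ∀ᶠ n in Filter.atTop, ∀ x, h n x ∈ A ↔ π x ∈ A := by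
    intro A hA
    obtain ⟨i, hi⟩ := hC ⟨A, hA⟩
    filter_upwards [Filter.eventually_gt_atTop i] with n hn
    have := hh n i hn
    rwa [hi] at this
  letI := homeoTop Cantor
  have hnhds : @nhds _ (actionTop Γ Cantor) α =
      Filter.comap (fun φ : Γ →* (Cantor ≃ₜ Cantor) => ⇑φ) (nhds ⇑α) := nhds_induced _ _
  rw [hnhds, Filter.tendsto_comap_iff, tendsto_pi_nhds]
  intro γ
  refine TopologicalSpace.tendsto_nhds_generateFrom_iff.2 ?_
  rintro U ⟨A, B, hA, hB, rfl⟩ hU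
  filter_upwards [hev A hA, hev B hB] with n hnA hnB
  change (fun z => h n (β γ ((h n).symm z))) '' A = B
  have hU' : ∀ x, x ∈ A ↔ α γ x ∈ B := by
    intro x
    rw [← show α γ '' A = B from hU]
    exact ((α γ).injective.mem_set_image).symm
  ext y
  constructor
  · rintro ⟨x, hx, rfl⟩
    show h n (β γ ((h n).symm x)) ∈ B
    rw [hnB, he, ← hU', ← hnA]
    simpa using hx
  · intro hy
    refine ⟨h n ((β γ).symm ((h n).symm y)), ?_, by simp⟩
    rw [hnA, hU', ← he, ← hnB]
    simpa using hy


/-- For an infinite countable group `Γ` there are actions with dense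
conjugacy class in `A(Γ)` and in `Min(Γ)`. -/
theorem stmt16 (Γ : Type*) [Group Γ] [Countable Γ] [Infinite Γ] :
    letI := actionTop Γ Cantor
    ((∃ α : Γ →* (Cantor ≃ₜ Cantor),
        Dense {ψ : Γ →* (Cantor ≃ₜ Cantor) |
          ∃ h : Cantor ≃ₜ Cantor, ∀ (γ : Γ) (x : Cantor), ψ γ x = h (α γ (h.symm x))}) ∧
      (∃ β : {α : Γ →* (Cantor ≃ₜ Cantor) //
                ∀ x : Cantor, Dense (Set.range fun γ : Γ => α γ x)},
        Dense {ψ : {α : Γ →* (Cantor ≃ₜ Cantor) //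
                ∀ x : Cantor, Dense (Set.range fun γ : Γ => α γ x)} |
          ∃ h : Cantor ≃ₜ Cantor, ∀ (γ : Γ) (x : Cantor),
            ψ.1 γ x = h (β.1 γ (h.symm x))})) := by
  letI := actionTop Γ Cantor
  have hsc : SecondCountableTopology (Γ →* (Cantor ≃ₜ Cantor)) := secondCountable_action Γ
  have hCne : Nonempty (ℕ → Cantor) := inferInstance
  refine ⟨?_, ?_⟩
  · obtain ⟨s, hs⟩ := TopologicalSpace.exists_dense_seq (Γ →* (Cantor ≃ₜ Cantor))
    obtain ⟨e⟩ : Nonempty ((ℕ → Cantor) ≃ₜ Cantor) := by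
      apply brouwer_cantor
      intro z hz
      have := (isOpenMap_eval (X := fun _ : ℕ => Cantor) 0) _ hz
      rw [Set.image_singleton] at this
      exact cantor_no_isolated _ this
    let b : Γ →* ((ℕ → Cantor) ≃ₜ (ℕ → Cantor)) := mkAct (fun g z n => s n g (z n))
      (fun z => funext fun n => act_one _ _) (fun g k z => funext fun n => act_mul _ _ _ _)
      (fun g => by fun_prop)
    refine ⟨conjAct e b, ?_⟩
    rw [← dense_closure]
    refine Dense.mono ?_ hs
    rintro _ ⟨n, rfl⟩
    obtain ⟨h, hh⟩ := factor_seq (s n) (conjAct e b) (fun x => e.symm x n) (by fun_prop)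
      (fun y => ⟨e (fun _ => y), by simp⟩)
      (fun γ x => by
        change e.symm (e (b γ (e.symm x))) n = _
        rw [e.symm_apply_apply]; rfl)
    exact mem_closure_of_tendsto hh (Filter.Eventually.of_forall fun k => ⟨h k, fun γ x => rfl⟩)
  · have hne : Nonempty {α : Γ →* (Cantor ≃ₜ Cantor) //
                ∀ x : Cantor, Dense (Set.range fun γ : Γ => α γ x)} := by
      obtain ⟨β, hβ⟩ := exists_min_action Γ
      exact ⟨⟨β, hβ⟩⟩
    have hsc2 : SecondCountableTopology {α : Γ →* (Cantor ≃ₜ Cantor) //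
                ∀ x : Cantor, Dense (Set.range fun γ : Γ => α γ x)} :=
      TopologicalSpace.secondCountableTopology_induced _ _ _
    obtain ⟨s, hs⟩ := TopologicalSpace.exists_dense_seq {α : Γ →* (Cantor ≃ₜ Cantor) //
                ∀ x : Cantor, Dense (Set.range fun γ : Γ => α γ x)}
    obtain ⟨β, p, hp, hβ, he⟩ := exists_minimal_cantor
      (fun (g : Γ) (z : ℕ → Cantor) n => (s n).1 g (z n))
      (fun z => funext fun n => act_one _ _) (fun g k z => funext fun n => act_mul _ _ _ _)
      (fun g => by fun_prop) Set.univ isClosed_univ Set.univ_nonempty (fun _ _ _ => Set.mem_univ _)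
      (by
        intro z _ hfin
        have h2 : (Set.range fun g => (s 0).1 g (z 0)).Finite := by
          refine (hfin.image (fun w => w 0)).subset ?_
          rintro _ ⟨g, rfl⟩
          exact ⟨_, ⟨g, rfl⟩, rfl⟩
        have h3 := ((s 0).2 (z 0)).closure_eq
        rw [h2.isClosed.closure_eq] at h3
        rw [h3] at h2
        exact Set.infinite_univ h2)
    refine ⟨⟨β, hβ⟩, ?_⟩
    rw [← dense_closure]
    refine Dense.mono ?_ hs
    rintro _ ⟨n, rfl⟩
    have hpn : Continuous fun x => p x n := by fun_prop
    have hen : ∀ γ x, p (β γ x) n = (s n).1 γ (p x n) := fun γ x => by rw [he]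
    have hsurj : Function.Surjective fun x => p x n := by
      have hcl : IsClosed (Set.range fun x => p x n) := (isCompact_range hpn).isClosed
      rw [← Set.range_eq_univ, ← hcl.closure_eq]
      refine Dense.closure_eq (((s n).2 (p (fun _ => true) n)).mono ?_)
      rintro _ ⟨γ, rfl⟩
      exact ⟨β γ (fun _ => true), hen _ _⟩
    obtain ⟨h, hh⟩ := factor_seq (s n).1 β (fun x => p x n) hpn hsurj hen
    have hh' : Filter.Tendsto (fun k => (⟨conjAct (h k) β, conj_minimal (h k) β hβ⟩ :
      {α : Γ →* (Cantor ≃ₜ Cantor) // ∀ x : Cantor, Dense (Set.range fun γ : Γ => α γ x)}))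
      Filter.atTop (nhds (s n)) := tendsto_subtype_rng.2 hh
    exact mem_closure_of_tendsto hh' (Filter.Eventually.of_forall fun k => ⟨h k, fun γ x => rfl⟩)
end

section
/- Let Γ be a countable group. Each of the following subsets of A(Γ) is a Gδ set: (1) the actions α with dynamical comparison; (2) the actions α such that T(α) is almost unperforated (for all a,b ∈ T(α) and n ∈ ℕ, (n+1)a ≤ nb implies a ≤ b); (3) the actions α such that T(α) is unperforated (for all a,b ∈ T(α) and n ≥ 1, na ≤ nb implies a ≤ b); (4) the actions α such that T(α) is cancellative (a+b = a+c implies b = c); (5) the actions α such that the algebraic preorder ≤ on T(α) is a partial order (antisymmetric). -/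
open MeasureTheory Set
open scoped ENNReal

open MeasureTheory Set Topology Filter TopologicalSpace

section Aux

variable {Γ : Type*} [Group Γ] {X : Type*} [TopologicalSpace X]

/-- Local constancy of images of clopen sets. -/
def LocConst [TopologicalSpace (Γ →* (X ≃ₜ X))] : Prop :=
  ∀ (α : Γ →* (X ≃ₜ X)) (γ : Γ) (A : Set X), IsClopen A →
    ∀ᶠ β : Γ →* (X ≃ₜ X) in 𝓝 α, ⇑(β γ) '' A = ⇑(α γ) '' A

theorem coe_inv_apply (α : Γ →* (X ≃ₜ X)) (γ : Γ) (x : X) : α γ (α γ⁻¹ x) = x := by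
  rw [map_inv]
  exact (α γ).apply_symm_apply x

theorem coe_inv_apply' (α : Γ →* (X ≃ₜ X)) (γ : Γ) (x : X) : α γ⁻¹ (α γ x) = x := by
  rw [map_inv]
  exact (α γ).symm_apply_apply x

theorem range_fin [CompactSpace X] (f : C(X, ℕ)) : (Set.range f).Finite :=
  (isCompact_range f.continuous).finite_of_discrete

theorem clopen_pre (f : C(X, ℕ)) (n : ℕ) : IsClopen (f ⁻¹' {n}) :=
  (isClopen_discrete {n}).preimage f.continuous

theorem ev_actC [CompactSpace X] [TopologicalSpace (Γ →* (X ≃ₜ X))]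
    (h : LocConst (Γ := Γ) (X := X)) (α : Γ →* (X ≃ₜ X)) (γ : Γ) (f : C(X, ℕ)) :
    ∀ᶠ β in 𝓝 α, actC β γ f = actC α γ f := by
  have h1 : ∀ᶠ β : Γ →* (X ≃ₜ X) in 𝓝 α, ∀ n ∈ Set.range f, ⇑(β γ) '' (f ⁻¹' {n}) = ⇑(α γ) '' (f ⁻¹' {n}) :=
    (Filter.eventually_all_finite (range_fin f)).2 fun n _ => h α γ _ (clopen_pre f n)
  filter_upwards [h1] with β hβ
  ext x
  change f (β γ⁻¹ x) = f (α γ⁻¹ x)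
  have hx : x ∈ ⇑(β γ) '' (f ⁻¹' {f (β γ⁻¹ x)}) := ⟨β γ⁻¹ x, rfl, coe_inv_apply β γ x⟩
  rw [hβ _ ⟨_, rfl⟩] at hx
  obtain ⟨y, hy, rfl⟩ := hx
  rw [coe_inv_apply' α γ y]
  exact hy.symm

theorem isOpen_cls [CompactSpace X] [TopologicalSpace (Γ →* (X ≃ₜ X))]
    (h : LocConst (Γ := Γ) (X := X)) (f g : C(X, ℕ)) :
    IsOpen {α : Γ →* (X ≃ₜ X) | cls α f = cls α g} := by
  rw [isOpen_iff_mem_nhds]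
  intro α hα
  have hα' : AddConGen.Rel (TypeRel α) f g := (AddCon.eq (typeCon α)).1 hα
  suffices hs : ∀ᶠ β in 𝓝 α, AddConGen.Rel (TypeRel β) f g by
    filter_upwards [hs] with β hβ
    exact (AddCon.eq (typeCon β)).2 hβ
  clear hα
  induction hα' with
  | of x y hxy =>
    obtain ⟨n, k, γ, h1, h2⟩ := hxy
    have : ∀ᶠ β : Γ →* (X ≃ₜ X) in 𝓝 α, ∀ i, actC β (γ i) (k i) = actC α (γ i) (k i) :=
      Filter.eventually_all.2 fun i => ev_actC h α _ _
    filter_upwards [this] with β hβ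
    refine .of _ _ ⟨n, k, γ, h1, ?_⟩
    rw [h2]
    exact Finset.sum_congr rfl fun i _ => (hβ i).symm
  | refl x => exact Eventually.of_forall fun β => .refl x
  | symm _ ih => exact ih.mono fun β hβ => hβ.symm
  | trans _ _ ih1 ih2 => exact (ih1.and ih2).mono fun β hβ => hβ.1.trans hβ.2
  | add _ _ ih1 ih2 => exact (ih1.and ih2).mono fun β hβ => hβ.1.add hβ.2

theorem cls_surj (α : Γ →* (X ≃ₜ X)) (a : TypeSemigroup α) : ∃ f, cls α f = a :=
  Quotient.exists_rep a

theorem cls_add (α : Γ →* (X ≃ₜ X)) (f g : C(X, ℕ)) : cls α f + cls α g = cls α (f + g) := rfl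

theorem cls_nsmul (α : Γ →* (X ≃ₜ X)) (n : ℕ) (f : C(X, ℕ)) : n • cls α f = cls α (n • f) := rfl

theorem isOpen_tle [CompactSpace X] [TopologicalSpace (Γ →* (X ≃ₜ X))]
    (h : LocConst (Γ := Γ) (X := X)) (f g : C(X, ℕ)) :
    IsOpen {α : Γ →* (X ≃ₜ X) | tle α (cls α f) (cls α g)} := by
  have : {α : Γ →* (X ≃ₜ X) | tle α (cls α f) (cls α g)} =
      ⋃ k : C(X, ℕ), {α : Γ →* (X ≃ₜ X) | cls α (f + k) = cls α g} := by
    ext α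
    simp only [mem_ofPred_eq, mem_iUnion]
    constructor
    · rintro ⟨c, hc⟩
      obtain ⟨k, rfl⟩ := cls_surj α c
      exact ⟨k, hc⟩
    · rintro ⟨k, hk⟩
      exact ⟨cls α k, hk⟩
  rw [this]
  exact isOpen_iUnion fun k => isOpen_cls h _ _

theorem isGδ_imp {Y : Type*} [TopologicalSpace Y] [PerfectlyNormalSpace Y] {P Q : Y → Prop}
    (hP : IsOpen {y | P y}) (hQ : IsOpen {y | Q y}) : IsGδ {y | P y → Q y} := by
  have : {y | P y → Q y} = {y | P y}ᶜ ∪ {y | Q y} := by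
    ext y; simp only [mem_ofPred_eq, mem_union, mem_compl_iff]; tauto
  rw [this]
  exact hP.isClosed_compl.isGδ.union hQ.isGδ

theorem isGδ_all {Y ι : Type*} [TopologicalSpace Y] [Countable ι] {P : ι → Y → Prop}
    (hP : ∀ i, IsGδ {y | P i y}) : IsGδ {y | ∀ i, P i y} := by
  rw [ofPred_forall]
  exact IsGδ.iInter hP

theorem countable_C [CompactSpace X] [Countable (Clopens X)] : Countable C(X, ℕ) := by
  classical
  let F : C(X, ℕ) → Finset (ℕ × Clopens X) := fun f =>
    (range_fin f).toFinset.image fun n => (n, ⟨f ⁻¹' {n}, clopen_pre f n⟩)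
  refine Function.Injective.countable (f := F) ?_
  intro f g hfg
  ext x
  have hx : (f x, (⟨f ⁻¹' {f x}, clopen_pre f _⟩ : Clopens X)) ∈ F f :=
    Finset.mem_image.2 ⟨f x, by simp, rfl⟩
  rw [hfg] at hx
  obtain ⟨m, -, hm⟩ := Finset.mem_image.1 hx
  obtain ⟨h1, h2⟩ := Prod.ext_iff.1 hm
  have h3 : g ⁻¹' {m} = f ⁻¹' {f x} := congrArg (fun C : Clopens X => (C : Set X)) h2
  have h4 : x ∈ g ⁻¹' {m} := by rw [h3]; rfl
  have h5 : g x = m := h4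
  rw [h5]; exact h1.symm

theorem isOpen_subeq [TopologicalSpace (Γ →* (X ≃ₜ X))]
    (h : LocConst (Γ := Γ) (X := X)) (A B : Set X) :
    IsOpen {α : Γ →* (X ≃ₜ X) | Subequidecomposable α A B} := by
  rw [isOpen_iff_mem_nhds]
  rintro α ⟨n, P, γ, h1, h2, h3, h4, h5⟩
  have : ∀ᶠ β : Γ →* (X ≃ₜ X) in 𝓝 α, ∀ i, ⇑(β (γ i)) '' P i = ⇑(α (γ i)) '' P i :=
    Filter.eventually_all.2 fun i => h α _ _ (h1 i)
  filter_upwards [this] with β hβ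
  refine ⟨n, P, γ, h1, h2, h3, ?_, ?_⟩
  · intro i j hij
    rw [hβ i, hβ j]
    exact h4 hij
  · intro i
    rw [hβ i]; exact h5 i

theorem isOpen_meas [CompactSpace X] [T2Space X] [TotallyDisconnectedSpace X]
    [SecondCountableTopology X] [TopologicalSpace (Γ →* (X ≃ₜ X))]
    (h : LocConst (Γ := Γ) (X := X)) (A B : Set X) (hA : IsClopen A) (hB : IsClopen B) :
    IsOpen {α : Γ →* (X ≃ₜ X) | ∀ μ ∈ invBorel α, μ A < μ B} := by
  letI : MeasurableSpace X := borel X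
  haveI : BorelSpace X := ⟨rfl⟩
  have hcont : ∀ C : Set X, IsClopen C →
      Continuous fun μ : ProbabilityMeasure X => (μ : Measure X) C := by
    intro C hC
    rw [continuous_iff_continuousAt]
    intro μ
    exact ProbabilityMeasure.tendsto_measure_of_null_frontier_of_tendsto' tendsto_id
      (by simp [hC.frontier_eq])
  have himg : ∀ (g : X ≃ₜ X) (C : Set X), IsClopen C → IsClopen (g '' C) := by
    intro g C hC
    exact ⟨g.isClosedMap _ hC.1, g.isOpenMap _ hC.2⟩
  let S : Set ((Γ →* (X ≃ₜ X)) × ProbabilityMeasure X) :=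
    {p | (∀ γ : Γ, ∀ C : Set X, IsClopen C →
      (p.2 : Measure X) (⇑(p.1 γ) '' C) = (p.2 : Measure X) C) ∧
      (p.2 : Measure X) B ≤ (p.2 : Measure X) A}
  have hS : IsClosed S := by
    have hE : S = (⋂ γ : Γ, ⋂ C : Set X, ⋂ _ : IsClopen C,
        {p : (Γ →* (X ≃ₜ X)) × ProbabilityMeasure X | (p.2 : Measure X) (⇑(p.1 γ) '' C) = (p.2 : Measure X) C}) ∩
        {p | (p.2 : Measure X) B ≤ (p.2 : Measure X) A} := by
      ext p; simp [S]
    rw [hE]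
    refine IsClosed.inter ?_ ?_
    · refine isClosed_iInter fun γ => isClosed_iInter fun C => isClosed_iInter fun hC => ?_
      refine isClosed_eq ?_ ((hcont C hC).comp continuous_snd)
      rw [continuous_iff_continuousAt]
      rintro ⟨α, μ⟩
      have h1 : ContinuousAt (fun p : (Γ →* (X ≃ₜ X)) × ProbabilityMeasure X =>
          (p.2 : Measure X) (⇑(α γ) '' C)) (α, μ) :=
        ((hcont _ (himg _ C hC)).comp continuous_snd).continuousAt
      refine h1.congr ?_
      have := (continuous_fst (X := Γ →* (X ≃ₜ X)) (Y := ProbabilityMeasure X)).continuousAt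
        (x := (α, μ)) |>.eventually (h α γ C hC)
      filter_upwards [this] with p hp
      rw [hp]
    · exact isClosed_le ((hcont B hB).comp continuous_snd) ((hcont A hA).comp continuous_snd)
  have hc := isClosedMap_fst_of_compactSpace S hS
  have : {α : Γ →* (X ≃ₜ X) | ∀ μ ∈ invBorel α, μ A < μ B} = (Prod.fst '' S)ᶜ := by
    ext α
    simp only [mem_ofPred_eq, mem_compl_iff]
    constructor
    · rintro hα ⟨⟨β, μ⟩, ⟨h1, h2⟩, rfl⟩
      refine absurd (hα μ ⟨inferInstance, fun γ => ?_⟩) (not_lt.2 h2)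
      have hgen : (inferInstance : MeasurableSpace X) =
          MeasurableSpace.generateFrom {s : Set X | IsClopen s} :=
        (isTopologicalBasis_isClopen (X := X)).borel_eq_generateFrom
      have hm : Measurable ⇑(β γ) := (β γ).continuous.measurable
      haveI : IsProbabilityMeasure (Measure.map ⇑(β γ) (μ : Measure X)) :=
        Measure.isProbabilityMeasure_map hm.aemeasurable
      refine ext_of_generate_finite _ hgen (fun s hs t ht _ => hs.inter ht) ?_ (by simp)
      intro s hs
      have hs' : IsClopen s := hs
      rw [Measure.map_apply hm hs'.1.measurableSet]
      have h3 := h1 γ _ (hs'.preimage (β γ).continuous)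
      dsimp only at h3
      rw [image_preimage_eq _ (β γ).surjective] at h3
      exact h3.symm
    · intro hα μ hμ
      by_contra hlt
      obtain ⟨hp, hinv⟩ := hμ
      refine hα ⟨⟨α, ⟨μ, hp⟩⟩, ⟨fun γ C hC => ?_, not_lt.1 hlt⟩, rfl⟩
      change μ (⇑(α γ) '' C) = μ C
      conv_lhs => rw [← hinv γ]
      rw [Measure.map_apply (α γ).continuous.measurable (himg _ C hC).1.measurableSet,
        preimage_image_eq _ (α γ).injective]
  rw [this]
  exact hc.isOpen_compl

/-- The image of a clopen set as a clopen set. -/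
def imgClopen (α : Γ →* (X ≃ₜ X)) (p : Γ × Clopens X) : Clopens X :=
  ⟨⇑(α p.1) '' p.2, (α p.1).isClosedMap _ p.2.2.1, (α p.1).isOpenMap _ p.2.2.2⟩

theorem exists_top [Countable Γ] [Countable (Clopens X)] :
    ∃ t : TopologicalSpace (Γ →* (X ≃ₜ X)), actionTop Γ X ≤ t ∧
      @PerfectlyNormalSpace _ t ∧ @LocConst Γ _ X _ t := by
  letI : TopologicalSpace (Clopens X) := ⊥
  haveI : DiscreteTopology (Clopens X) := ⟨rfl⟩
  let t : TopologicalSpace (Γ →* (X ≃ₜ X)) :=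
    TopologicalSpace.induced (imgClopen (Γ := Γ) (X := X)) inferInstance
  refine ⟨t, ?_, ?_, ?_⟩
  · letI := homeoTop X
    letI := actionTop Γ X
    rw [← continuous_iff_le_induced]
    refine continuous_pi fun p => ?_
    rw [continuous_discrete_rng]
    intro C
    have h1 : (fun φ : Γ →* (X ≃ₜ X) => imgClopen φ p) ⁻¹' {C} =
        (fun φ : Γ →* (X ≃ₜ X) => φ p.1) ⁻¹' {g | ⇑g '' p.2 = C} := by
      ext α
      exact SetLike.ext'_iff
    have h2 : Continuous fun φ : Γ →* (X ≃ₜ X) => φ p.1 :=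
      (continuous_apply p.1).comp (continuous_induced_dom (f := fun φ : Γ →* (X ≃ₜ X) => ⇑φ))
    rw [h1]
    have h3 : IsOpen {g : X ≃ₜ X | ⇑g '' (p.2 : Set X) = C} :=
      TopologicalSpace.GenerateOpen.basic _ ⟨_, _, p.2.2, C.2, rfl⟩
    exact h3.preimage h2
  · haveI : PseudoMetrizableSpace (Γ →* (X ≃ₜ X)) :=
      IsInducing.pseudoMetrizableSpace (f := imgClopen (Γ := Γ) (X := X)) ⟨rfl⟩
    letI := pseudoMetrizableSpacePseudoMetric (Γ →* (X ≃ₜ X))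
    infer_instance
  · intro α γ A hA
    have h1 : Continuous fun β : Γ →* (X ≃ₜ X) => imgClopen β (γ, ⟨A, hA⟩) :=
      (continuous_apply (γ, (⟨A, hA⟩ : Clopens X))).comp
        (continuous_induced_dom (f := imgClopen (Γ := Γ) (X := X)))
    have h2 := h1.continuousAt (x := α) |>.eventually
      ((isOpen_discrete {imgClopen α (γ, ⟨A, hA⟩)}).mem_nhds rfl)
    filter_upwards [h2] with β hβ
    exact congrArg (fun C : Clopens X => (C : Set X)) hβ

theorem gdelta_mono {Y : Type*} {s t : TopologicalSpace Y} (hst : s ≤ t) {U : Set Y}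
    (hU : @IsGδ Y t U) : @IsGδ Y s U := by
  obtain ⟨T, h1, h2, h3⟩ := hU
  exact ⟨T, fun u hu => hst u (h1 u hu), h2, h3⟩

end Aux

/-- Each of the following subsets of `A(Γ)` is a `Gδ` set: actions with
dynamical comparison; actions whose type semigroup is almost unperforated; unperforated;
cancellative; actions for which the algebraic preorder is a partial order. -/
theorem stmt17 (Γ : Type*) [Group Γ] [Countable Γ] :
    letI := actionTop Γ Cantor
    (IsGδ {α : Γ →* (Cantor ≃ₜ Cantor) | DynComparisonBorel α} ∧
     IsGδ {α : Γ →* (Cantor ≃ₜ Cantor) | IsAlmostUnperforated α} ∧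
     IsGδ {α : Γ →* (Cantor ≃ₜ Cantor) | IsUnperforated α} ∧
     IsGδ {α : Γ →* (Cantor ≃ₜ Cantor) | IsCancellative α} ∧
     IsGδ {α : Γ →* (Cantor ≃ₜ Cantor) | TleAntisymm α}) := by
  haveI : Countable (Clopens Cantor) :=
    TopologicalSpace.Clopens.countable_iff_secondCountable.2 inferInstance
  haveI : Countable C(Cantor, ℕ) := countable_C
  obtain ⟨t, hle, hpn, hlc⟩ := exists_top (Γ := Γ) (X := Cantor)
  refine ⟨gdelta_mono hle ?_, gdelta_mono hle ?_, gdelta_mono hle ?_, gdelta_mono hle ?_,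
    gdelta_mono hle ?_⟩
  · have : {α : Γ →* (Cantor ≃ₜ Cantor) | DynComparisonBorel α} =
        {α | ∀ A B : Clopens Cantor, (∀ μ ∈ invBorel α, μ A < μ B) →
          ((B : Set Cantor).Nonempty → Subequidecomposable α A B)} := by
      ext α
      exact ⟨fun h A B h1 h2 => h A B A.2 B.2 h2 h1,
        fun h A B hA hB h2 h1 => h ⟨A, hA⟩ ⟨B, hB⟩ h1 h2⟩
    rw [this]
    refine isGδ_all fun A => isGδ_all fun B => isGδ_imp (isOpen_meas hlc A B A.2 B.2) ?_
    by_cases hB : (B : Set Cantor).Nonempty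
    · simpa [hB] using isOpen_subeq hlc (A : Set Cantor) B
    · simp [hB]
  · have : {α : Γ →* (Cantor ≃ₜ Cantor) | IsAlmostUnperforated α} =
        {α | ∀ (f g : C(Cantor, ℕ)) (n : ℕ), tle α (cls α ((n + 1) • f)) (cls α (n • g)) →
          tle α (cls α f) (cls α g)} := by
      ext α
      refine ⟨fun h f g n => h (cls α f) (cls α g) n, fun h a b n => ?_⟩
      obtain ⟨f, rfl⟩ := cls_surj α a
      obtain ⟨g, rfl⟩ := cls_surj α b
      exact h f g n
    rw [this]
    exact isGδ_all fun f => isGδ_all fun g => isGδ_all fun n =>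
      isGδ_imp (isOpen_tle hlc _ _) (isOpen_tle hlc _ _)
  · have : {α : Γ →* (Cantor ≃ₜ Cantor) | IsUnperforated α} =
        {α | ∀ (f g : C(Cantor, ℕ)) (n : {n : ℕ // 1 ≤ n}),
          tle α (cls α (n.1 • f)) (cls α (n.1 • g)) → tle α (cls α f) (cls α g)} := by
      ext α
      refine ⟨fun h f g n => h (cls α f) (cls α g) n.1 n.2, fun h a b n hn => ?_⟩
      obtain ⟨f, rfl⟩ := cls_surj α a
      obtain ⟨g, rfl⟩ := cls_surj α b
      exact h f g ⟨n, hn⟩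
    rw [this]
    exact isGδ_all fun f => isGδ_all fun g => isGδ_all fun n =>
      isGδ_imp (isOpen_tle hlc _ _) (isOpen_tle hlc _ _)
  · have : {α : Γ →* (Cantor ≃ₜ Cantor) | IsCancellative α} =
        {α | ∀ (f g k : C(Cantor, ℕ)), cls α (f + g) = cls α (f + k) → cls α g = cls α k} := by
      ext α
      refine ⟨fun h f g k => h (cls α f) (cls α g) (cls α k), fun h a b c => ?_⟩
      obtain ⟨f, rfl⟩ := cls_surj α a
      obtain ⟨g, rfl⟩ := cls_surj α b
      obtain ⟨k, rfl⟩ := cls_surj α c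
      exact h f g k
    rw [this]
    exact isGδ_all fun f => isGδ_all fun g => isGδ_all fun k =>
      isGδ_imp (isOpen_cls hlc _ _) (isOpen_cls hlc _ _)
  · have : {α : Γ →* (Cantor ≃ₜ Cantor) | TleAntisymm α} =
        {α | ∀ (f g : C(Cantor, ℕ)), (tle α (cls α f) (cls α g) ∧ tle α (cls α g) (cls α f)) →
          cls α f = cls α g} := by
      ext α
      refine ⟨fun h f g hh => h (cls α f) (cls α g) hh.1 hh.2, fun h a b h1 h2 => ?_⟩
      obtain ⟨f, rfl⟩ := cls_surj α a
      obtain ⟨g, rfl⟩ := cls_surj α b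
      exact h f g ⟨h1, h2⟩
    rw [this]
    exact isGδ_all fun f => isGδ_all fun g =>
      isGδ_imp ((isOpen_tle hlc _ _).inter (isOpen_tle hlc _ _)) (isOpen_cls hlc _ _)
end
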